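/- arXiv:math/0401069 — 2 statements merged into one kernel-verified Lean document; each statement's English description precedes it below -/
import Mathlib

section
/- Let 𝔾 be a finite connected transitive graph and let λ > 0 with 1 < λV^{1/3} < V. If the triangle condition ∇_{p_c}(x,y) ≤ δ_{x,y} + a₀ holds for all vertices x, y with some constant a₀ < 1, then 1 − ε₀ ≤ Ω·p_c ≤ (1 − ε₀)/(1 − a₀). -/
noncomputable section
open Classical

namespace Percolation

variable {V : Type*} [Fintype V] [DecidableEq V]

/-- A percolation configuration: an assignment of occupied (`true`) or
vacant (`false`) to each bond of the graph. -/
def Config (G : SimpleGraph V) : Type _ := G.edgeSet → Bool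

noncomputable instance (G : SimpleGraph V) : Fintype G.edgeSet :=
  Fintype.ofFinite _

noncomputable instance (G : SimpleGraph V) : Fintype (Config G) :=
  inferInstanceAs (Fintype (G.edgeSet → Bool))

/-- The probability weight of a configuration under the product Bernoulli
measure with parameter `p`. -/
def weight (G : SimpleGraph V) (p : ℝ) (ω : Config G) : ℝ :=
  ∏ e : G.edgeSet, if ω e then p else 1 - p

/-- The probability of an event under the percolation measure `ℙ_p`. -/
def prob (G : SimpleGraph V) (p : ℝ) (A : Config G → Prop) : ℝ :=
  ∑ ω : Config G, if A ω then weight G p ω else 0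

/-- The expectation of a random variable under the percolation measure `ℙ_p`. -/
def expect (G : SimpleGraph V) (p : ℝ) (f : Config G → ℝ) : ℝ :=
  ∑ ω : Config G, weight G p ω * f ω

/-- The subgraph consisting of the occupied bonds of a configuration. -/
def occupied (G : SimpleGraph V) (ω : Config G) : SimpleGraph V :=
  SimpleGraph.fromEdgeSet {e | ∃ h : e ∈ G.edgeSet, ω ⟨e, h⟩ = true}

/-- The cluster `C(x)` of the vertex `x`: all vertices joined to `x` by a path
of occupied bonds (including `x` itself). -/
def cluster (G : SimpleGraph V) (ω : Config G) (x : V) : Finset V :=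
  Finset.univ.filter fun y => (occupied G ω).Reachable x y

/-- The susceptibility `χ(p)`: the expected size of the cluster of `x₀`. -/
def chi (G : SimpleGraph V) (x₀ : V) (p : ℝ) : ℝ :=
  expect G p fun ω => ((cluster G ω x₀).card : ℝ)

/-- The two-point function `τ_p(x,y) = ℙ_p(x ↔ y)`. -/
def tau (G : SimpleGraph V) (p : ℝ) (x y : V) : ℝ :=
  prob G p fun ω => (occupied G ω).Reachable x y

/-- The triangle diagram `∇_p(x,y)`. -/
def triangle (G : SimpleGraph V) (p : ℝ) (x y : V) : ℝ :=
  ∑ u : V, ∑ v : V, tau G p x u * tau G p u v * tau G p v y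

/-- The Kronecker delta `δ_{x,y}`. -/
def kron (x y : V) : ℝ := if x = y then 1 else 0

/-- `∇̄_p`: the maximum of the triangle diagram over bonds `{x,y} ∈ 𝔹`. -/
def nablaBar (G : SimpleGraph V) (p : ℝ) : ℝ :=
  sSup {t : ℝ | ∃ x y : V, G.Adj x y ∧ t = triangle G p x y}

/-- A graph is (vertex-)transitive if any vertex can be mapped to any other
by a graph automorphism. -/
def IsTransitive (G : SimpleGraph V) : Prop :=
  ∀ x y : V, ∃ φ : G ≃g G, φ x = y

/-- The size `|C_max|` of the largest cluster. -/
def maxCluster (G : SimpleGraph V) (ω : Config G) : ℕ :=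
  Finset.univ.sup fun x => (cluster G ω x).card

/-- The cluster size distribution `P_{≥k}(p) = ℙ_p(|C(x₀)| ≥ k)`. -/
def Pgeq (G : SimpleGraph V) (x₀ : V) (p : ℝ) (k : ℝ) : ℝ :=
  prob G p fun ω => k ≤ ((cluster G ω x₀).card : ℝ)

/-- The magnetization `M(p,γ)`. -/
def magnetization (G : SimpleGraph V) (x₀ : V) (p γ : ℝ) : ℝ :=
  ∑ k ∈ Finset.Icc 1 (Fintype.card V),
    (1 - (1 - γ) ^ k) * prob G p fun ω => (cluster G ω x₀).card = k

/-- `Z_{≥s}`: the number of vertices lying in clusters of size at least `s`. -/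
def Zgeq (G : SimpleGraph V) (s : ℝ) (ω : Config G) : ℝ :=
  ∑ x : V, if s ≤ ((cluster G ω x).card : ℝ) then (1 : ℝ) else 0

/-- The variance of a random variable under `ℙ_p`. -/
def variance (G : SimpleGraph V) (p : ℝ) (f : Config G → ℝ) : ℝ :=
  expect G p (fun ω => f ω ^ 2) - (expect G p f) ^ 2

/-- The restricted susceptibility `χ_{≥s}(p) = 𝔼_p[|C(x₀)| I[|C(x₀)| ≥ s]]`. -/
def chiGeq (G : SimpleGraph V) (x₀ : V) (p : ℝ) (s : ℝ) : ℝ :=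
  expect G p fun ω =>
    if s ≤ ((cluster G ω x₀).card : ℝ) then ((cluster G ω x₀).card : ℝ) else 0

/-- The restricted susceptibility `χ_{<s}(p) = 𝔼_p[|C(x₀)| I[|C(x₀)| < s]]`. -/
def chiLt (G : SimpleGraph V) (x₀ : V) (p : ℝ) (s : ℝ) : ℝ :=
  expect G p fun ω =>
    if ((cluster G ω x₀).card : ℝ) < s then ((cluster G ω x₀).card : ℝ) else 0

end Percolation
namespace PercAux

set_option linter.unusedSectionVars false

section BK
variable {α : Type*} [DecidableEq α]

/-- Bernoulli weight of `T` inside `s`. -/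
def bw (p : ℝ) (s T : Finset α) : ℝ := ∏ e ∈ s, if e ∈ T then p else 1 - p

/-- Bernoulli probability of a family of finite sets. -/
def bm (p : ℝ) (s : Finset α) (A : Finset α → Prop) : ℝ :=
  ∑ T ∈ s.powerset, if A T then bw p s T else 0

/-- Disjoint occurrence. -/
def box (A B : Finset α → Prop) (T : Finset α) : Prop :=
  ∃ I J : Finset α, Disjoint I J ∧ I ⊆ T ∧ J ⊆ T ∧ A I ∧ B J

/-- Increasing events. -/
def Incr (A : Finset α → Prop) : Prop := ∀ S T : Finset α, S ⊆ T → A S → A T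

lemma bw_nonneg {p : ℝ} (h0 : 0 ≤ p) (h1 : p ≤ 1) (s T : Finset α) : 0 ≤ bw p s T := by
  unfold bw
  apply Finset.prod_nonneg
  intro i _
  split_ifs <;> linarith

lemma bm_mono {p : ℝ} (h0 : 0 ≤ p) (h1 : p ≤ 1) (s : Finset α) {A B : Finset α → Prop}
    (h : ∀ T, A T → B T) : bm p s A ≤ bm p s B := by
  unfold bm
  apply Finset.sum_le_sum
  intro T _
  have := bw_nonneg h0 h1 s T
  by_cases hA : A T
  · simp [hA, h T hA]
  · simp only [hA, if_false]
    split_ifs <;> simp [this]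

lemma bm_insert (p : ℝ) (s : Finset α) (a : α) (ha : a ∉ s) (A : Finset α → Prop) :
    bm p (insert a s) A = (1 - p) * bm p s A + p * bm p s (fun T => A (insert a T)) := by
  unfold bm
  rw [Finset.sum_powerset_insert ha, Finset.mul_sum, Finset.mul_sum]
  congr 1
  · apply Finset.sum_congr rfl
    intro T hT
    have haT : a ∉ T := fun h => ha (Finset.mem_powerset.1 hT h)
    have : bw p (insert a s) T = (1 - p) * bw p s T := by
      unfold bw
      rw [Finset.prod_insert ha]; simp [haT]
    rw [this]; split_ifs <;> simp
  · apply Finset.sum_congr rfl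
    intro T hT
    have : bw p (insert a s) (insert a T) = p * bw p s T := by
      unfold bw
      rw [Finset.prod_insert ha]
      simp only [Finset.mem_insert_self, if_true]
      congr 1
      apply Finset.prod_congr rfl
      intro e he
      have : e ≠ a := fun h => ha (h ▸ he)
      simp [this]
    rw [this]; split_ifs <;> simp

lemma box_incr {A B : Finset α → Prop} : Incr (box A B) := by
  rintro S T h ⟨I, J, h1, h2, h3, h4⟩
  exact ⟨I, J, h1, h2.trans h, h3.trans h, h4⟩

/-- The van den Berg and Kesten inequality for increasing events. -/
theorem bk {p : ℝ} (h0 : 0 ≤ p) (h1 : p ≤ 1) (s : Finset α) :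
    ∀ A B : Finset α → Prop, Incr A → Incr B → bm p s (box A B) ≤ bm p s A * bm p s B := by
  induction s using Finset.induction with
  | empty =>
    intro A B _ _
    have h : box A B ∅ → A ∅ ∧ B ∅ := by
      rintro ⟨I, J, _, hI, hJ, hA, hB⟩
      rw [Finset.subset_empty] at hI hJ
      subst hI; subst hJ; exact ⟨hA, hB⟩
    simp only [bm, bw, Finset.powerset_empty, Finset.sum_singleton, Finset.prod_empty]
    by_cases hb : box A B ∅
    · simp [hb, h hb]
    · simp only [hb, if_false]; split_ifs <;> simp
  | insert a s ha ih =>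
    intro A B hA hB
    have hA1 : Incr (fun T => A (insert a T)) := fun S T h =>
      hA _ _ (Finset.insert_subset_insert a h)
    have hB1 : Incr (fun T => B (insert a T)) := fun S T h =>
      hB _ _ (Finset.insert_subset_insert a h)
    have e00 := ih A B hA hB
    have e10 := ih _ B hA1 hB
    have e01 := ih A _ hA hB1
    have e11 := ih _ _ hA1 hB1
    rw [bm_insert p s a ha, bm_insert p s a ha, bm_insert p s a ha]
    have a01 : bm p s A ≤ bm p s (fun T => A (insert a T)) :=
      bm_mono h0 h1 s fun T => hA _ _ (Finset.subset_insert a T)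
    have b01 : bm p s B ≤ bm p s (fun T => B (insert a T)) :=
      bm_mono h0 h1 s fun T => hB _ _ (Finset.subset_insert a T)
    have hAA : ∀ T, A T → A (insert a T) := fun T => hA _ _ (Finset.subset_insert a T)
    have hBB : ∀ T, B T → B (insert a T) := fun T => hB _ _ (Finset.subset_insert a T)
    have key : ∀ T, box A B (insert a T) →
        box (fun T => A (insert a T)) B T ∨ box A (fun T => B (insert a T)) T := by
      rintro T ⟨I, J, hd, hI, hJ, hAI, hBJ⟩
      by_cases haI : a ∈ I
      · left
        have haJ : a ∉ J := Finset.disjoint_left.1 hd haI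
        refine ⟨I.erase a, J, Finset.disjoint_of_subset_left (Finset.erase_subset _ _) hd,
          ?_, ?_, ?_, hBJ⟩
        · intro x hx
          have := hI (Finset.mem_of_mem_erase hx)
          exact (Finset.mem_insert.1 this).resolve_left (Finset.ne_of_mem_erase hx)
        · intro x hx
          exact (Finset.mem_insert.1 (hJ hx)).resolve_left (fun h => haJ (h ▸ hx))
        · simpa [Finset.insert_erase haI] using hAI
      · right
        refine ⟨I, J.erase a, Finset.disjoint_of_subset_right (Finset.erase_subset _ _) hd,
          ?_, ?_, hAI, ?_⟩
        · intro x hx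
          exact (Finset.mem_insert.1 (hI hx)).resolve_left (fun h => haI (h ▸ hx))
        · intro x hx
          have := hJ (Finset.mem_of_mem_erase hx)
          exact (Finset.mem_insert.1 this).resolve_left (Finset.ne_of_mem_erase hx)
        · refine hB _ _ ?_ hBJ
          intro x hx
          by_cases h : x = a
          · simp [h]
          · simp [h, hx]
    have hu : bm p s (fun T => box A B (insert a T)) + bm p s (box A B) ≤
        bm p s (box (fun T => A (insert a T)) B) + bm p s (box A (fun T => B (insert a T))) := by
      unfold bm
      rw [← Finset.sum_add_distrib, ← Finset.sum_add_distrib]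
      apply Finset.sum_le_sum
      intro T _
      have hw := bw_nonneg h0 h1 s T
      by_cases c : box A B T
      · have c1 : box (fun T => A (insert a T)) B T := by
          obtain ⟨I, J, q1, q2, q3, q4, q5⟩ := c
          exact ⟨I, J, q1, q2, q3, hAA _ q4, q5⟩
        have c2 : box A (fun T => B (insert a T)) T := by
          obtain ⟨I, J, q1, q2, q3, q4, q5⟩ := c
          exact ⟨I, J, q1, q2, q3, q4, hBB _ q5⟩
        simp only [c, c1, c2, if_true]
        split_ifs <;> linarith
      · by_cases d : box A B (insert a T)
        · rcases key T d with k | k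
          · simp only [c, d, k, if_true, if_false]
            split_ifs <;> linarith
          · simp only [c, d, k, if_true, if_false]
            split_ifs <;> linarith
        · simp only [c, d, if_false]
          split_ifs <;> linarith
    have hu2 : bm p s (fun T => box A B (insert a T)) ≤
        bm p s (box (fun T => A (insert a T)) (fun T => B (insert a T))) := by
      apply bm_mono h0 h1
      intro T hT
      rcases key T hT with ⟨I, J, q1, q2, q3, q4, q5⟩ | ⟨I, J, q1, q2, q3, q4, q5⟩
      · exact ⟨I, J, q1, q2, q3, q4, hBB _ q5⟩
      · exact ⟨I, J, q1, q2, q3, hAA _ q4, q5⟩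
    generalize bm p s (fun T => box A B (insert a T)) = mu at *
    generalize bm p s (box A B) = m00 at *
    generalize bm p s (box (fun T => A (insert a T)) B) = m10 at *
    generalize bm p s (box A (fun T => B (insert a T))) = m01 at *
    generalize bm p s (box (fun T => A (insert a T)) (fun T => B (insert a T))) = m11 at *
    generalize bm p s (fun T => A (insert a T)) = a1 at *
    generalize bm p s (fun T => B (insert a T)) = b1 at *
    generalize bm p s A = a0 at *
    generalize bm p s B = b0 at *
    have hab : 0 ≤ (a1 - a0) * (b1 - b0) := mul_nonneg (by linarith) (by linarith)
    rcases le_total p (1 / 2) with hp | hp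
    · have e1 : p * (mu + m00) ≤ p * (a1 * b0 + a0 * b1) :=
        mul_le_mul_of_nonneg_left (by linarith) h0
      have e2 : (1 - 2 * p) * m00 ≤ (1 - 2 * p) * (a0 * b0) :=
        mul_le_mul_of_nonneg_left e00 (by linarith)
      have e3 := mul_nonneg (mul_nonneg h0 h0) hab
      nlinarith
    · have e1 : (1 - p) * (mu + m00) ≤ (1 - p) * (a1 * b0 + a0 * b1) :=
        mul_le_mul_of_nonneg_left (by linarith) (by linarith)
      have e2 : (2 * p - 1) * mu ≤ (2 * p - 1) * (a1 * b1) :=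
        mul_le_mul_of_nonneg_left (by linarith) (by linarith)
      have e3 := mul_nonneg (mul_nonneg (sub_nonneg.2 h1) (sub_nonneg.2 h1)) hab
      nlinarith

end BK

section Russo
variable {E : Type*} [Fintype E] [DecidableEq E]

/-- Product weight. -/
def wt (p : ℝ) (ω : E → Bool) : ℝ := ∏ e, if ω e then p else 1 - p

/-- Coordinates that are true. -/
def tset (ω : E → Bool) : Finset E := Finset.univ.filter fun e => ω e = true

lemma wt_nonneg {p : ℝ} (h0 : 0 ≤ p) (h1 : p ≤ 1) (ω : E → Bool) : 0 ≤ wt p ω := by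
  unfold wt
  apply Finset.prod_nonneg
  intro i _
  split_ifs <;> linarith

lemma sum_prod_bool (g : E → Bool → ℝ) :
    ∑ ω : E → Bool, ∏ e, g e (ω e) = ∏ e, (g e true + g e false) := by
  have := Finset.prod_univ_sum (fun _ : E => (Finset.univ : Finset Bool)) g
  rw [Fintype.piFinset_univ] at this
  rw [← this]
  simp

lemma wt_sum (p : ℝ) : ∑ ω : E → Bool, wt p ω = 1 := by
  unfold wt
  rw [sum_prod_bool (fun _ b => if b then p else 1 - p)]
  simp

lemma wt_edge (p : ℝ) (e : E) : ∑ ω : E → Bool, (if ω e = true then wt p ω else 0) = p := by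
  have h := sum_prod_bool
    (fun e' b => if e' = e ∧ b = false then 0 else if b then p else 1 - p)
  have h2 : ∀ ω : E → Bool, (if ω e = true then wt p ω else 0) =
      ∏ e', (if e' = e ∧ ω e' = false then 0 else if ω e' then p else 1 - p) := by
    intro ω
    by_cases hω : ω e = true
    · rw [if_pos hω]
      apply Finset.prod_congr rfl
      intro e' _
      have hn : ¬ (e' = e ∧ ω e' = false) := by
        rintro ⟨h1, h2⟩
        rw [h1, hω] at h2
        exact absurd h2 (by decide)
      rw [if_neg hn]
    · rw [if_neg hω]
      symm
      apply Finset.prod_eq_zero (Finset.mem_univ e)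
      simp at hω
      simp [hω]
  rw [Finset.sum_congr rfl (fun ω _ => h2 ω), h]
  rw [Finset.prod_eq_single e]
  · simp
  · intro b _ hb; simp [hb]
  · simp

lemma sum_flip (e : E) (h : (E → Bool) → ℝ) :
    ∑ ω : E → Bool, h ω =
      ∑ ω : E → Bool, (if ω e then 0 else h ω + h (Function.update ω e true)) := by
  have inv : Function.Involutive (fun ω : E → Bool => Function.update ω e (!ω e)) := by
    intro ω
    simp
  have h1 : ∑ ω : E → Bool, (if ω e then h ω else 0) =
      ∑ ω : E → Bool, (if ω e then 0 else h (Function.update ω e true)) := by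
    rw [← Equiv.sum_comp inv.toPerm]
    apply Finset.sum_congr rfl
    intro ω _
    simp only [Function.Involutive.coe_toPerm, Function.update_self]
    cases hω : ω e <;> simp
  calc ∑ ω : E → Bool, h ω
      = ∑ ω : E → Bool, ((if ω e then h ω else 0) + (if ω e then 0 else h ω)) := by
        apply Finset.sum_congr rfl
        intro ω _
        split_ifs <;> simp
    _ = _ := by
        rw [Finset.sum_add_distrib, h1, ← Finset.sum_add_distrib]
        apply Finset.sum_congr rfl
        intro ω _
        split_ifs <;> ring

/-- Russo's formula. -/
theorem russo (f : (E → Bool) → ℝ) (p : ℝ) :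
    ∃ D, HasDerivAt (fun q => ∑ ω : E → Bool, wt q ω * f ω) D p ∧
      (1 - p) * D = ∑ e, ∑ ω : E → Bool,
        (if ω e then 0 else wt p ω * (f (Function.update ω e true) - f ω)) := by
  refine ⟨∑ ω : E → Bool, (∑ e, (∏ j ∈ Finset.univ.erase e, (if ω j then p else 1 - p)) •
    (if ω e then (1 : ℝ) else -1)) * f ω, ?_, ?_⟩
  · apply HasDerivAt.fun_sum
    intro ω _
    apply HasDerivAt.mul_const
    unfold wt
    apply HasDerivAt.fun_finsetProd
    intro e _
    cases ω e
    · simpa using (hasDerivAt_id' p).const_sub 1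
    · simpa using hasDerivAt_id' p
  · rw [Finset.mul_sum]
    simp only [Finset.sum_mul, Finset.mul_sum]
    rw [Finset.sum_comm]
    apply Finset.sum_congr rfl
    intro e _
    rw [sum_flip e]
    apply Finset.sum_congr rfl
    intro ω _
    by_cases hω : ω e = true
    · simp [hω]
    · simp only [hω]
      have h1 : ∏ j ∈ Finset.univ.erase e,
          (if (Function.update ω e true) j = true then p else 1 - p) =
          ∏ j ∈ Finset.univ.erase e, (if ω j = true then p else 1 - p) := by
        apply Finset.prod_congr rfl
        intro j hj
        rw [Function.update_of_ne (Finset.ne_of_mem_erase hj)]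
      have h2 : wt p ω = (1 - p) * ∏ j ∈ Finset.univ.erase e, (if ω j = true then p else 1 - p) := by
        unfold wt
        rw [← Finset.mul_prod_erase _ _ (Finset.mem_univ e)]
        simp [hω]
      rw [h1, h2]
      simp
      ring

/-- swapping pairs of configurations according to a random set of coordinates. -/
lemma swap_sum (p : ℝ) (K : (E → Bool) → E → Prop)
    (hK : ∀ ω ω' : E → Bool, (∀ e, K ω e → ω e = ω' e) → K ω' = K ω)
    (F : (E → Bool) → ℝ) :
    ∑ ω : E → Bool, ∑ ω' : E → Bool, wt p ω * wt p ω' *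
      F (fun e => if K ω e then ω e else ω' e) = ∑ ω : E → Bool, wt p ω * F ω := by
  let T : (E → Bool) × (E → Bool) → (E → Bool) × (E → Bool) := fun z =>
    (fun e => if K z.1 e then z.1 e else z.2 e, fun e => if K z.1 e then z.2 e else z.1 e)
  have hK1 : ∀ z, K (T z).1 = K z.1 := by
    intro z
    apply hK
    intro e he
    simp [T, he]
  have inv : Function.Involutive T := by
    intro z
    apply Prod.ext
    · funext e
      change (if K (T z).1 e then (T z).1 e else (T z).2 e) = z.1 e
      rw [hK1]
      by_cases he : K z.1 e <;> simp [T, he]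
    · funext e
      change (if K (T z).1 e then (T z).2 e else (T z).1 e) = z.2 e
      rw [hK1]
      by_cases he : K z.1 e <;> simp [T, he]
  have hw : ∀ z, wt p (T z).1 * wt p (T z).2 = wt p z.1 * wt p z.2 := by
    intro z
    unfold wt
    rw [← Finset.prod_mul_distrib, ← Finset.prod_mul_distrib]
    apply Finset.prod_congr rfl
    intro e _
    by_cases he : K z.1 e
    · simp only [T, he, if_true]
    · simp only [T, he, if_false]; ring
  have h1 : ∑ z : (E → Bool) × (E → Bool), wt p z.1 * wt p z.2 * F (T z).1 =
      ∑ z : (E → Bool) × (E → Bool), wt p z.1 * wt p z.2 * F z.1 := by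
    rw [← Equiv.sum_comp inv.toPerm (fun z => wt p z.1 * wt p z.2 * F z.1)]
    apply Finset.sum_congr rfl
    intro z _
    simp only [Function.Involutive.coe_toPerm, hw]
  rw [Fintype.sum_prod_type, Fintype.sum_prod_type] at h1
  refine h1.trans ?_
  apply Finset.sum_congr rfl
  intro ω _
  have : ∀ ω' : E → Bool, wt p ω * wt p ω' * F ω = wt p ω * F ω * wt p ω' := by intros; ring
  simp only [this]
  rw [← Finset.mul_sum, wt_sum, mul_one]

lemma bm_univ (p : ℝ) (A : Finset E → Prop) :
    bm p Finset.univ A =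
      ∑ ω : E → Bool, if A (tset ω) then wt p ω else 0 := by
  unfold bm
  rw [Finset.powerset_univ]
  refine Finset.sum_bij' (fun T _ => fun e => decide (e ∈ T))
    (fun ω _ => tset ω) ?_ ?_ ?_ ?_ ?_
  · simp
  · simp
  · intro T _; ext e; simp [tset]
  · intro ω _; funext e; simp [tset]
  · intro T _
    have : tset (fun e => decide (e ∈ T)) = T := by ext e; simp [tset]
    simp only [this]
    simp [bw, wt]

end Russo

set_option linter.unusedSectionVars false

section Graph
open Percolation
variable {V : Type*} [Fintype V] [DecidableEq V] (G : SimpleGraph V)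

/-- Subgraph with the bonds in `T`. -/
def sg (T : Finset G.edgeSet) : SimpleGraph V :=
  SimpleGraph.fromEdgeSet (Subtype.val '' (T : Set G.edgeSet))

/-- Occupied bonds. -/
def occ (ω : Config G) : Finset G.edgeSet := tset (E := G.edgeSet) ω

/-- Connection event. -/
def conn (x y : V) (T : Finset G.edgeSet) : Prop := (sg G T).Reachable x y

lemma occupied_eq (ω : Config G) : occupied G ω = sg G (occ G ω) := by
  unfold occupied sg occ
  congr 1
  ext e
  simp [tset]

lemma occupied_adj (ω : Config G) (a b : V) :
    (occupied G ω).Adj a b ↔ ∃ h : s(a, b) ∈ G.edgeSet, ω ⟨s(a, b), h⟩ = true := by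
  unfold occupied
  rw [SimpleGraph.fromEdgeSet_adj]
  constructor
  · rintro ⟨h, _⟩; exact h
  · rintro ⟨h, h2⟩
    exact ⟨⟨h, h2⟩, (SimpleGraph.mem_edgeSet G |>.1 h).ne⟩

lemma conn_incr (x y : V) : Incr (conn G x y) := by
  intro S T h hS
  apply SimpleGraph.Reachable.mono _ hS
  apply SimpleGraph.fromEdgeSet_mono
  exact Set.image_mono (by exact_mod_cast h)

lemma prob_bm (p : ℝ) (A : Finset G.edgeSet → Prop) :
    prob G p (fun ω => A (occ G ω)) = bm p Finset.univ A := by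
  rw [bm_univ]
  exact Fintype.sum_equiv (Equiv.refl _) _ _ (fun _ => rfl)

lemma tau_bm (p : ℝ) (x y : V) : tau G p x y = bm p Finset.univ (conn G x y) := by
  rw [← prob_bm]
  unfold tau conn
  simp only [occupied_eq]

lemma weight_nonneg {p : ℝ} (h0 : 0 ≤ p) (h1 : p ≤ 1) (ω : Config G) : 0 ≤ weight G p ω :=
  wt_nonneg h0 h1 ω

lemma prob_nonneg {p : ℝ} (h0 : 0 ≤ p) (h1 : p ≤ 1) (A : Config G → Prop) :
    0 ≤ prob G p A := by
  unfold prob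
  apply Finset.sum_nonneg
  intro ω _
  have := weight_nonneg G h0 h1 ω
  split_ifs <;> simp [this]

lemma prob_le_sum {p : ℝ} (h0 : 0 ≤ p) (h1 : p ≤ 1) {ι : Type*} [Fintype ι]
    (A : Config G → Prop) (B : ι → Config G → Prop) (h : ∀ ω, A ω → ∃ i, B i ω) :
    prob G p A ≤ ∑ i, prob G p (B i) := by
  unfold prob
  rw [Finset.sum_comm]
  apply Finset.sum_le_sum
  intro ω _
  have hw := weight_nonneg G h0 h1 ω
  have hn : ∀ i ∈ Finset.univ, 0 ≤ (if B i ω then weight G p ω else 0) := by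
    intro i _; split_ifs <;> simp [hw]
  by_cases hA : A ω
  · obtain ⟨i, hi⟩ := h ω hA
    have := Finset.single_le_sum hn (Finset.mem_univ i)
    simpa [hA, hi] using this
  · simp only [hA, if_false]
    exact Finset.sum_nonneg hn

/-- Bonds used by a walk. -/
def edg {H : SimpleGraph V} {a b : V} (q : H.Walk a b) : Finset G.edgeSet :=
  Finset.univ.filter fun e => e.1 ∈ q.edges

variable {G}

lemma sg_edge {T : Finset G.edgeSet} {e : Sym2 V} :
    e ∈ (sg G T).edgeSet ↔ ∃ h : e ∈ G.edgeSet, (⟨e, h⟩ : G.edgeSet) ∈ T := by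
  unfold sg
  rw [SimpleGraph.edgeSet_fromEdgeSet]
  constructor
  · rintro ⟨⟨e', h, rfl⟩, _⟩
    exact ⟨e'.2, h⟩
  · rintro ⟨h, h2⟩
    exact ⟨⟨_, h2, rfl⟩, G.not_isDiag_of_mem_edgeSet h⟩

lemma conn_edg {T : Finset G.edgeSet} {a b : V} (q : (sg G T).Walk a b) :
    conn G a b (edg G q) := by
  refine ⟨q.transfer _ ?_⟩
  intro e he
  obtain ⟨h, _⟩ := sg_edge.1 (q.edges_subset_edgeSet he)
  exact sg_edge.2 ⟨h, by simp [edg, he]⟩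

lemma edg_sub {T : Finset G.edgeSet} {a b : V} (q : (sg G T).Walk a b) : edg G q ⊆ T := by
  intro e he
  simp only [edg, Finset.mem_filter, Finset.mem_univ, true_and] at he
  obtain ⟨h, h2⟩ := sg_edge.1 (q.edges_subset_edgeSet he)
  exact h2

lemma edg_disj {H : SimpleGraph V} {a b c d : V} (q : H.Walk a b) (r : H.Walk c d)
    (h : ∀ e, e ∈ q.edges → e ∉ r.edges) : Disjoint (edg G q) (edg G r) := by
  rw [Finset.disjoint_left]
  intro e he he'
  simp only [edg, Finset.mem_filter, Finset.mem_univ, true_and] at he he'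
  exact h _ he he'

lemma path_split {H : SimpleGraph V} {a b z : V} (q : H.Walk a b) (hq : q.IsPath)
    (hz : z ∈ q.support) :
    ∀ e, e ∈ (q.takeUntil z hz).edges → e ∉ (q.dropUntil z hz).edges := by
  have h1 := hq.isTrail.edges_nodup
  rw [← q.take_spec hz, SimpleGraph.Walk.edges_append] at h1
  intro e h2 h3
  exact (List.nodup_append'.1 h1).2.2 h2 h3

lemma split_box {T : Finset G.edgeSet} {a b z : V} (q : (sg G T).Walk a b) (hq : q.IsPath)
    (hz : z ∈ q.support) : box (conn G a z) (conn G z b) T :=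
  ⟨_, _, edg_disj _ _ (path_split q hq hz), edg_sub _, edg_sub _, conn_edg _, conn_edg _⟩

lemma walk_to {H : SimpleGraph V} {x u a b : V} (q : H.Walk x u) (r : H.Walk a b)
    (hb : b ∈ q.support) :
    ∃ z, ∃ r' : H.Walk a z, z ∈ q.support ∧ ∀ e ∈ r'.edges, e ∉ q.edges := by
  induction r with
  | nil => exact ⟨_, SimpleGraph.Walk.nil, hb, by simp⟩
  | @cons a c b h r ih =>
    by_cases ha : a ∈ q.support
    · exact ⟨a, SimpleGraph.Walk.nil, ha, by simp⟩
    · obtain ⟨z, r', hz, hr⟩ := ih hb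
      refine ⟨z, SimpleGraph.Walk.cons h r', hz, ?_⟩
      intro e he
      rw [SimpleGraph.Walk.edges_cons, List.mem_cons] at he
      rcases he with rfl | he
      · intro hq
        exact ha (q.fst_mem_support_of_mem_edges hq)
      · exact hr e he

lemma conn_symm {T : Finset G.edgeSet} {a b : V} (h : conn G a b T) : conn G b a T :=
  SimpleGraph.Reachable.symm h

lemma tree_box {T : Finset G.edgeSet} {x u w : V} (h1 : conn G x u T) (h2 : conn G x w T) :
    ∃ z, box (conn G x z) (box (conn G z u) (conn G z w)) T := by
  obtain ⟨q, hq⟩ := h1.exists_isPath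
  obtain ⟨r⟩ := conn_symm h2
  obtain ⟨z, r', hz, hr⟩ := walk_to q r q.start_mem_support
  have d1 : Disjoint (edg G (q.takeUntil z hz)) (edg G (q.dropUntil z hz)) :=
    edg_disj _ _ (path_split q hq hz)
  have d2 : Disjoint (edg G (q.takeUntil z hz)) (edg G r') := by
    apply edg_disj
    intro e he he'
    exact hr e he' (q.edges_takeUntil_subset_edges hz he)
  have d3 : Disjoint (edg G (q.dropUntil z hz)) (edg G r') := by
    apply edg_disj
    intro e he he'
    exact hr e he' (q.edges_dropUntil_subset_edges hz he)
  refine ⟨z, edg G (q.takeUntil z hz), edg G (q.dropUntil z hz) ∪ edg G r', ?_, edg_sub _,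
    Finset.union_subset (edg_sub _) (edg_sub _), conn_edg _, ?_⟩
  · exact Finset.disjoint_union_right.2 ⟨d1, d2⟩
  · exact ⟨_, _, d3, Finset.subset_union_left, Finset.subset_union_right, conn_edg _,
      conn_symm (conn_edg r')⟩

/-- Edge event. -/
def edgeEv (G : SimpleGraph V) (x u : V) (T : Finset G.edgeSet) : Prop :=
  ∃ h : s(x, u) ∈ G.edgeSet, (⟨s(x, u), h⟩ : G.edgeSet) ∈ T

lemma edgeEv_incr (x u : V) : Incr (edgeEv G x u) := by
  rintro S T h ⟨h1, h2⟩
  exact ⟨h1, h h2⟩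

lemma first_box {T : Finset G.edgeSet} {x y : V} (hxy : x ≠ y) (h : conn G x y T) :
    ∃ u, box (edgeEv G x u) (conn G u y) T := by
  obtain ⟨q, hq⟩ := h.exists_isPath
  cases q with
  | nil => exact absurd rfl hxy
  | @cons _ u _ ha r =>
    obtain ⟨g1, g2⟩ := sg_edge.1 ((sg G T).mem_edgeSet.2 ha)
    have hnd := hq.isTrail.edges_nodup
    rw [SimpleGraph.Walk.edges_cons, List.nodup_cons] at hnd
    refine ⟨u, {⟨s(x, u), g1⟩}, edg G r, ?_, by simpa using g2, edg_sub _, ⟨g1, by simp⟩,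
      conn_edg _⟩
    rw [Finset.disjoint_singleton_left]
    simp [edg, hnd.1]

lemma tau_symm (p : ℝ) (x y : V) : tau G p x y = tau G p y x := by
  unfold tau
  congr 1
  funext ω
  exact propext ⟨fun h => h.symm, fun h => h.symm⟩

lemma tau_nonneg {p : ℝ} (h0 : 0 ≤ p) (h1 : p ≤ 1) (x y : V) : 0 ≤ tau G p x y :=
  prob_nonneg G h0 h1 _

lemma tree_graph {p : ℝ} (h0 : 0 ≤ p) (h1 : p ≤ 1) (x u w : V) :
    prob G p (fun ω => (occupied G ω).Reachable x u ∧ (occupied G ω).Reachable x w) ≤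
      ∑ z, tau G p x z * (tau G p z u * tau G p z w) := by
  refine (prob_le_sum G h0 h1 _ (fun z ω =>
    box (conn G x z) (box (conn G z u) (conn G z w)) (occ G ω)) ?_).trans ?_
  · rintro ω ⟨q1, q2⟩
    rw [occupied_eq] at q1 q2
    exact tree_box q1 q2
  · apply Finset.sum_le_sum
    intro z _
    rw [prob_bm, tau_bm, tau_bm, tau_bm]
    refine (bk h0 h1 _ _ _ (conn_incr G _ _) box_incr).trans ?_
    apply mul_le_mul_of_nonneg_left (bk h0 h1 _ _ _ (conn_incr G _ _) (conn_incr G _ _))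
    rw [← tau_bm]
    exact tau_nonneg h0 h1 _ _

lemma prob_edge (p : ℝ) (x u : V) :
    bm p Finset.univ (edgeEv G x u) = if G.Adj x u then p else 0 := by
  rw [bm_univ]
  by_cases h : G.Adj x u
  · rw [if_pos h]
    have h' : s(x, u) ∈ G.edgeSet := h
    have := wt_edge p (⟨s(x, u), h'⟩ : G.edgeSet)
    refine Eq.trans ?_ this
    apply Finset.sum_congr rfl
    intro ω _
    simp [edgeEv, h, tset]
  · rw [if_neg h]
    apply Finset.sum_eq_zero
    intro ω _
    rw [if_neg]
    rintro ⟨h1, _⟩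
    exact h h1

lemma tau_first {p : ℝ} (h0 : 0 ≤ p) (h1 : p ≤ 1) (x y : V) (hxy : x ≠ y) :
    tau G p x y ≤ ∑ u, (if G.Adj x u then p else 0) * tau G p u y := by
  unfold tau
  refine (prob_le_sum G h0 h1 _ (fun u ω =>
    box (edgeEv G x u) (conn G u y) (occ G ω)) ?_).trans ?_
  · intro ω h
    rw [occupied_eq] at h
    exact first_box hxy h
  · apply Finset.sum_le_sum
    intro u _
    rw [prob_bm, ← prob_edge]
    change _ ≤ _ * tau G p u y
    rw [tau_bm]
    exact bk h0 h1 _ _ _ (edgeEv_incr _ _) (conn_incr G _ _)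

lemma weight_sum (p : ℝ) : ∑ ω : Config G, weight G p ω = 1 := wt_sum (E := G.edgeSet) p

lemma tau_le_one {p : ℝ} (h0 : 0 ≤ p) (h1 : p ≤ 1) (x y : V) : tau G p x y ≤ 1 := by
  rw [← weight_sum (G := G) p]
  unfold tau prob
  apply Finset.sum_le_sum
  intro ω _
  have := weight_nonneg G h0 h1 ω
  split_ifs <;> simp [this]

lemma tau_self (p : ℝ) (x : V) : tau G p x x = 1 := by
  rw [← weight_sum (G := G) p]
  unfold tau prob
  apply Finset.sum_congr rfl
  intro ω _
  rw [if_pos (SimpleGraph.Reachable.refl _)]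

lemma card_cluster (ω : Config G) (x : V) :
    ((cluster G ω x).card : ℝ) = ∑ y, if (occupied G ω).Reachable x y then 1 else 0 := by
  unfold cluster
  rw [Finset.sum_boole]

lemma chi_eq (p : ℝ) (x : V) : chi G x p = ∑ y, tau G p x y := by
  unfold chi expect tau prob
  simp only [card_cluster]
  rw [Finset.sum_comm]
  apply Finset.sum_congr rfl
  intro ω _
  rw [Finset.mul_sum]
  apply Finset.sum_congr rfl
  intro y _
  split_ifs <;> simp

lemma chi_ge_one {p : ℝ} (h0 : 0 ≤ p) (h1 : p ≤ 1) (x : V) : 1 ≤ chi G x p := by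
  rw [chi_eq, ← tau_self (G := G) p x]
  exact Finset.single_le_sum (fun y _ => tau_nonneg h0 h1 x y) (Finset.mem_univ x)

lemma chi_first {p : ℝ} (h0 : 0 ≤ p) (h1 : p ≤ 1) (x : V) :
    chi G x p ≤ 1 + ∑ u, (if G.Adj x u then p else 0) * chi G u p := by
  have hn : ∀ u y, 0 ≤ (if G.Adj x u then p else 0) * tau G p u y := by
    intro u y
    apply mul_nonneg _ (tau_nonneg h0 h1 _ _)
    split_ifs <;> simp [h0]
  have : ∀ y, tau G p x y ≤ (if x = y then 1 else 0) +
      ∑ u, (if G.Adj x u then p else 0) * tau G p u y := by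
    intro y
    by_cases hxy : x = y
    · subst hxy
      rw [tau_self, if_pos rfl]
      linarith [Finset.sum_nonneg (fun u (_ : u ∈ Finset.univ) => hn u x)]
    · rw [if_neg hxy, zero_add]
      exact tau_first h0 h1 x y hxy
  rw [chi_eq]
  refine (Finset.sum_le_sum fun y _ => this y).trans ?_
  rw [Finset.sum_add_distrib, Finset.sum_comm]
  simp only [chi_eq, Finset.mul_sum]
  simp

lemma reach_occ (ω : Config G) (x y : V) :
    (occupied G ω).Reachable x y ↔ conn G x y (occ G ω) := by
  rw [occupied_eq]; rfl

lemma occ_edge (ω : Config G) (e : Sym2 V) :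
    e ∈ (occupied G ω).edgeSet ↔ ∃ h : e ∈ G.edgeSet, ω ⟨e, h⟩ = true := by
  rw [occupied_eq, sg_edge]
  simp [occ, tset]

lemma sum_config (F : Config G → ℝ) :
    ∑ ω : Config G, F ω = ∑ ω : G.edgeSet → Bool, F ω :=
  Fintype.sum_equiv (Equiv.refl _) _ _ (fun _ => rfl)

/-- Bonds touching the cluster of `x`. -/
def touch (x : V) (ω : G.edgeSet → Bool) (e : G.edgeSet) : Prop :=
  ∃ a, a ∈ e.1 ∧ (occupied G ω).Reachable x a

lemma reach_congr (x : V) (ω ω' : G.edgeSet → Bool)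
    (h : ∀ e, touch x ω e → ω e = ω' e) (y : V) :
    (occupied G ω').Reachable x y ↔ (occupied G ω).Reachable x y := by
  constructor
  · intro hr
    rw [SimpleGraph.reachable_iff_reflTransGen] at hr
    induction hr with
    | refl => exact SimpleGraph.Reachable.refl _
    | @tail b c _ hbc ih =>
      obtain ⟨h1, h2⟩ := (occupied_adj G ω' b c).1 hbc
      have := h ⟨s(b, c), h1⟩ ⟨b, by simp, ih⟩
      have hadj : (occupied G ω).Adj b c := (occupied_adj G ω b c).2 ⟨h1, this.trans h2⟩
      exact ih.trans hadj.reachable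
  · intro hr
    rw [SimpleGraph.reachable_iff_reflTransGen] at hr
    induction hr with
    | refl => exact SimpleGraph.Reachable.refl _
    | @tail b c hxb hbc ih =>
      obtain ⟨h1, h2⟩ := (occupied_adj G ω b c).1 hbc
      have := h ⟨s(b, c), h1⟩
        ⟨b, by simp, (SimpleGraph.reachable_iff_reflTransGen _ _).2 hxb⟩
      have hadj : (occupied G ω').Adj b c := (occupied_adj G ω' b c).2 ⟨h1, this.symm.trans h2⟩
      exact ih.trans hadj.reachable

lemma touch_congr (x : V) (ω ω' : G.edgeSet → Bool)
    (h : ∀ e, touch x ω e → ω e = ω' e) : touch x ω' = touch x ω := by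
  funext e
  unfold touch
  simp only [reach_congr x ω ω' h]

lemma sum_ite_mul_wt {p : ℝ} (A : Config G → Prop) :
    prob G p A = ∑ ω : G.edgeSet → Bool, wt p ω * (if A ω then 1 else 0) := by
  unfold prob
  rw [sum_config]
  apply Finset.sum_congr rfl
  intro ω _
  rw [mul_ite, mul_one, mul_zero]
  rfl

/-- `x ↔ u`, `v ↔ y`, but not `x ↔ v`. -/
def evD (x u v y : V) (ω : Config G) : Prop :=
  (occupied G ω).Reachable x u ∧ (occupied G ω).Reachable v y ∧
    ¬ (occupied G ω).Reachable x v

/-- `x ↔ u` and `x ↔ w`. -/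
def evX (x u w : V) (ω : Config G) : Prop :=
  (occupied G ω).Reachable x u ∧ (occupied G ω).Reachable x w

/-- The key lower bound on the event that `x` is joined to `u`, `v` to `y`, but `x` not to `v`. -/
lemma lower {p : ℝ} (h0 : 0 ≤ p) (h1 : p ≤ 1) (x u v y : V) :
    tau G p x u * tau G p v y ≤
      prob G p (evD x u v y) +
      ∑ w, prob G p (evX x u w) *
        (tau G p v w * tau G p w y) := by
  have hbk : ∀ w, prob G p (fun ω => box (conn G v w) (conn G w y) (occ G ω)) ≤
      tau G p v w * tau G p w y := by
    intro w
    rw [prob_bm, tau_bm, tau_bm]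
    exact bk h0 h1 _ _ _ (conn_incr G _ _) (conn_incr G _ _)
  refine le_trans ?_ (add_le_add_right (Finset.sum_le_sum fun w _ =>
    mul_le_mul_of_nonneg_left (hbk w) (prob_nonneg G h0 h1 _)) _)
  have hsw := swap_sum p (touch (G := G) x) (touch_congr x) (fun ω =>
    if evD (G := G) x u v y ω then 1 else 0)
  rw [sum_ite_mul_wt (evD x u v y), ← hsw]
  unfold tau
  simp only [sum_ite_mul_wt]
  simp only [Finset.sum_mul_sum]
  rw [Finset.sum_comm' (s := Finset.univ) (t := fun _ : V => Finset.univ)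
    (t' := Finset.univ) (s' := fun _ => Finset.univ) (by simp)]
  rw [← Finset.sum_add_distrib]
  apply Finset.sum_le_sum
  intro ω _
  rw [Finset.sum_comm (s := (Finset.univ : Finset V))]
  rw [← Finset.sum_add_distrib]
  apply Finset.sum_le_sum
  intro ω' _
  have hw := mul_nonneg (wt_nonneg h0 h1 ω) (wt_nonneg h0 h1 ω')
  have hn : ∀ w ∈ (Finset.univ : Finset V), 0 ≤
      wt p ω * (if evX (G := G) x u w ω then 1 else 0) *
      (wt p ω' * (if box (conn G v w) (conn G w y) (occ G ω') then 1 else 0)) := by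
    intro w _
    have h1' := wt_nonneg h0 h1 ω
    have h2' := wt_nonneg h0 h1 ω'
    apply mul_nonneg <;> apply mul_nonneg <;> first | assumption | (split_ifs <;> simp)
  have hs := Finset.sum_nonneg hn
  have hfirst : ∀ P : Prop, 0 ≤ wt p ω * wt p ω' * (if P then (1 : ℝ) else 0) := by
    intro P
    apply mul_nonneg hw
    split_ifs <;> simp
  by_cases hxu : (occupied G ω).Reachable x u
  swap
  · rw [if_neg hxu, mul_zero, zero_mul]
    exact add_nonneg (hfirst _) hs
  by_cases hvy : (occupied G ω').Reachable v y
  swap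
  · rw [if_neg hvy, mul_zero, mul_zero]
    exact add_nonneg (hfirst _) hs
  rw [if_pos hxu, if_pos hvy, mul_one, mul_one]
  have hvy' := (reach_occ ω' v y).1 hvy
  obtain ⟨q, hq⟩ := hvy'.exists_isPath
  by_cases hin : ∃ w ∈ q.support, (occupied G ω).Reachable x w
  · obtain ⟨w, hwq, hxw⟩ := hin
    have hb : box (conn G v w) (conn G w y) (occ G ω') := split_box q hq hwq
    have := Finset.single_le_sum hn (Finset.mem_univ w)
    have hX : evX (G := G) x u w ω := ⟨hxu, hxw⟩
    rw [if_pos hX, if_pos hb, mul_one, mul_one] at this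
    linarith [hfirst (evD (G := G) x u v y (fun e => if touch x ω e then ω e else ω' e))]
  · push Not at hin
    have hc := reach_congr x ω (fun e => if touch x ω e then ω e else ω' e)
      (by intro e he; simp [he])
    rw [if_pos, mul_one]
    · linarith
    · refine ⟨(hc u).2 hxu, ?_, fun h => hin v q.start_mem_support ((hc v).1 h)⟩
      refine ⟨q.transfer _ ?_⟩
      intro e he
      obtain ⟨h2, h3⟩ := sg_edge.1 (q.edges_subset_edgeSet he)
      refine (occ_edge _ e).2 ⟨h2, ?_⟩
      have hnt : ¬ touch x ω ⟨e, h2⟩ := by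
        rintro ⟨a, ha, hxa⟩
        exact hin a (SimpleGraph.Walk.mem_support_of_mem_edges he ha) hxa
      simp only [occ, tset, Finset.mem_filter, Finset.mem_univ, true_and] at h3
      rw [if_neg hnt]
      exact h3

/-- `x ↔ y`. -/
def evC (x y : V) (ω : Config G) : Prop := (occupied G ω).Reachable x y

lemma tau_evC (p : ℝ) (x y : V) : tau G p x y = prob G p (evC x y) := rfl

lemma occupied_update_le (ω : G.edgeSet → Bool) (e : G.edgeSet) :
    occupied G ω ≤ occupied G (Function.update ω e true) := by
  intro a b h
  obtain ⟨h1, h2⟩ := (occupied_adj G ω a b).1 h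
  refine (occupied_adj G _ a b).2 ⟨h1, ?_⟩
  by_cases he : (⟨s(a, b), h1⟩ : G.edgeSet) = e
  · rw [he]; simp
  · rw [Function.update_of_ne he]; exact h2

lemma deriv_mono (f : (G.edgeSet → Bool) → ℝ)
    (hf : ∀ ω e, f ω ≤ f (Function.update ω e true)) :
    MonotoneOn (fun q => ∑ ω : G.edgeSet → Bool, wt q ω * f ω) (Set.Icc 0 1) := by
  choose D hD hD2 using russo f
  apply monotoneOn_of_deriv_nonneg (convex_Icc 0 1)
  · exact fun q _ => (hD q).continuousAt.continuousWithinAt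
  · exact fun q _ => (hD q).differentiableAt.differentiableWithinAt
  · intro q hq
    rw [interior_Icc] at hq
    rw [(hD q).deriv]
    have h1 : 0 ≤ (1 - q) * D q := by
      rw [hD2 q]
      apply Finset.sum_nonneg
      intro e _
      apply Finset.sum_nonneg
      intro ω _
      split_ifs
      · exact le_rfl
      · exact mul_nonneg (wt_nonneg hq.1.le hq.2.le ω) (sub_nonneg.2 (hf ω e))
    have h2 : 0 < 1 - q := by linarith [hq.2]
    exact nonneg_of_mul_nonneg_right h1 h2

lemma tau_mono {p q : ℝ} (h0 : 0 ≤ p) (hpq : p ≤ q) (h1 : q ≤ 1) (x y : V) :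
    tau G p x y ≤ tau G q x y := by
  rw [tau_evC, tau_evC, sum_ite_mul_wt, sum_ite_mul_wt]
  refine deriv_mono (G := G) (fun ω => if evC (G := G) x y ω then 1 else 0) ?_
    ⟨h0, hpq.trans h1⟩ ⟨h0.trans hpq, h1⟩ hpq
  intro ω e
  by_cases h : evC (G := G) x y ω
  · have h2 : evC (G := G) x y (Function.update ω e true) :=
      SimpleGraph.Reachable.mono (occupied_update_le ω e) h
    simp only [h, h2, if_true]; exact le_rfl
  · simp only [h, if_false]; split_ifs <;> simp

lemma triangle_mono {p q : ℝ} (h0 : 0 ≤ p) (hpq : p ≤ q) (h1 : q ≤ 1) (x y : V) :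
    triangle G p x y ≤ triangle G q x y := by
  unfold triangle
  apply Finset.sum_le_sum
  intro u _
  apply Finset.sum_le_sum
  intro v _
  have n := fun a b => tau_nonneg (G := G) h0 (hpq.trans h1) a b
  have n' := fun a b => tau_nonneg (G := G) (h0.trans hpq) h1 a b
  have m := fun a b => tau_mono (G := G) h0 hpq h1 a b
  exact mul_le_mul (mul_le_mul (m _ _) (m _ _) (n _ _) (n' _ _)) (m _ _) (n _ _)
    (mul_nonneg (n' _ _) (n' _ _))

/-- size increase -/
def gain (x : V) (ω : Config G) (u v : V) : ℝ :=
  ∑ y, if evD x u v y ω then 1 else 0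

lemma gain_nonneg (x : V) (ω : Config G) (u v : V) : 0 ≤ gain x ω u v := by
  unfold gain
  apply Finset.sum_nonneg
  intro y _
  split_ifs <;> simp

lemma gain_eq_zero (x : V) (ω : Config G) (u v : V)
    (h : (occupied G ω).Reachable x u → (occupied G ω).Reachable x v) : gain x ω u v = 0 := by
  unfold gain
  apply Finset.sum_eq_zero
  intro y _
  rw [if_neg]
  rintro ⟨h1, _, h3⟩
  exact h3 (h h1)

lemma gain_le (x : V) (ω : G.edgeSet → Bool) (u v : V) (h : s(u, v) ∈ G.edgeSet) :
    gain x ω u v ≤ ((cluster G (Function.update ω ⟨s(u, v), h⟩ true) x).card : ℝ) -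
      ((cluster G ω x).card : ℝ) := by
  refine le_of_le_of_eq ?_ (congrArg₂ (fun a b : ℝ => a - b)
    (card_cluster (G := G) (Function.update ω ⟨s(u, v), h⟩ true) x)
    (card_cluster (G := G) ω x)).symm
  rw [← Finset.sum_sub_distrib]
  unfold gain
  apply Finset.sum_le_sum
  intro y _
  have hle := occupied_update_le ω ⟨s(u, v), h⟩
  by_cases hD : evD (G := G) x u v y ω
  · obtain ⟨a, b, c⟩ := hD
    have hadj : (occupied G (Function.update ω ⟨s(u, v), h⟩ true)).Adj u v :=
      (occupied_adj G _ u v).2 ⟨h, by simp⟩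
    have r1 : (occupied G (Function.update ω ⟨s(u, v), h⟩ true)).Reachable x y :=
      ((a.mono hle).trans hadj.reachable).trans (b.mono hle)
    have r2 : ¬ (occupied G ω).Reachable x y := fun h => c (h.trans b.symm)
    have hD : evD (G := G) x u v y ω := ⟨a, b, c⟩
    rw [if_pos hD, if_pos r1, if_neg r2]
    norm_num
  · rw [if_neg hD]
    by_cases r : (occupied G ω).Reachable x y
    · rw [if_pos r, if_pos (r.mono hle)]; norm_num
    · rw [if_neg r]; split_ifs <;> norm_num

lemma gain_edge (x : V) (ω : G.edgeSet → Bool) (e : G.edgeSet) :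
    ∑ u, ∑ v, (if s(u, v) = e.1 then gain x ω u v else 0) ≤
      if ω e then 0 else ((cluster G (Function.update ω e true) x).card : ℝ) -
      ((cluster G ω x).card : ℝ) := by
  obtain ⟨e, he⟩ := e
  induction e using Sym2.ind with
  | _ a b =>
  have hne : a ≠ b := (G.mem_edgeSet.1 he).ne
  have hs : ∑ u, ∑ v, (if s(u, v) = s(a, b) then gain x ω u v else 0) =
      gain x ω a b + gain x ω b a := by
    rw [← Fintype.sum_prod_type' (f := fun u v => if s(u, v) = s(a, b) then gain x ω u v else 0)]
    rw [← Finset.sum_filter]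
    have : (Finset.univ.filter fun z : V × V => s(z.1, z.2) = s(a, b)) = {(a, b), (b, a)} := by
      ext ⟨u, v⟩
      simp
    rw [this, Finset.sum_pair]
    intro h
    exact hne (Prod.ext_iff.1 h).1
  rw [hs]
  have g1 := gain_le x ω a b he
  have he' : s(b, a) ∈ G.edgeSet := by rwa [Sym2.eq_swap]
  have g2 := gain_le x ω b a he'
  have hee : (⟨s(b, a), he'⟩ : G.edgeSet) = ⟨s(a, b), he⟩ := Subtype.ext Sym2.eq_swap
  rw [hee] at g2
  by_cases hω : ω ⟨s(a, b), he⟩ = true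
  · have hadj : (occupied G ω).Adj a b := (occupied_adj G ω a b).2 ⟨he, hω⟩
    rw [if_pos hω, gain_eq_zero x ω a b fun h => h.trans hadj.reachable,
      gain_eq_zero x ω b a fun h => h.trans hadj.symm.reachable]
    simp
  · rw [if_neg hω]
    by_cases hb : (occupied G ω).Reachable x b
    · rw [gain_eq_zero x ω a b fun _ => hb]
      linarith
    · rw [gain_eq_zero x ω b a fun h => absurd h hb]
      linarith

lemma chi_deriv {p : ℝ} (h0 : 0 ≤ p) (h1 : p ≤ 1) (x : V) :
    ∃ D, HasDerivAt (chi G x) D p ∧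
      ∑ u, ∑ v, (if G.Adj u v then ∑ y, prob G p (evD x u v y) else 0) ≤ (1 - p) * D := by
  obtain ⟨D, hD, hD2⟩ := russo (E := G.edgeSet) (fun ω => ((cluster G ω x).card : ℝ)) p
  refine ⟨D, ?_, ?_⟩
  · have : chi G x = fun q => ∑ ω : G.edgeSet → Bool, wt q ω * ((cluster G ω x).card : ℝ) := by
      funext q
      unfold chi expect
      rw [sum_config]
      rfl
    rw [this]
    exact hD
  · rw [hD2]
    have e1 : ∀ u v, (if G.Adj u v then ∑ y, prob G p (evD (G := G) x u v y) else 0) =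
        ∑ e : G.edgeSet, ∑ ω : G.edgeSet → Bool,
          wt p ω * (if s(u, v) = e.1 then gain (G := G) x ω u v else 0) := by
      intro u v
      by_cases h : G.Adj u v
      · rw [if_pos h, Finset.sum_eq_single (⟨s(u, v), h⟩ : G.edgeSet)]
        · simp only [if_true, gain, Finset.mul_sum]
          rw [Finset.sum_comm]
          apply Finset.sum_congr rfl
          intro y _
          rw [sum_ite_mul_wt]
        · intro e _ he
          apply Finset.sum_eq_zero
          intro ω _
          rw [if_neg, mul_zero]
          intro h2
          exact he (Subtype.ext h2.symm)
        · simp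
      · rw [if_neg h]
        symm
        apply Finset.sum_eq_zero
        intro e _
        apply Finset.sum_eq_zero
        intro ω _
        rw [if_neg, mul_zero]
        intro h2
        apply h
        rw [← G.mem_edgeSet, h2]
        exact e.2
    simp only [e1]
    have e2 : ∀ u, ∑ v, ∑ e : G.edgeSet, ∑ ω : G.edgeSet → Bool,
          wt p ω * (if s(u, v) = e.1 then gain (G := G) x ω u v else 0) =
        ∑ e : G.edgeSet, ∑ ω : G.edgeSet → Bool, ∑ v,
          wt p ω * (if s(u, v) = e.1 then gain (G := G) x ω u v else 0) := by
      intro u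
      rw [Finset.sum_comm]
      apply Finset.sum_congr rfl
      intro e _
      rw [Finset.sum_comm]
    simp only [e2]
    rw [Finset.sum_comm]
    apply Finset.sum_le_sum
    intro e _
    rw [Finset.sum_comm]
    apply Finset.sum_le_sum
    intro ω _
    simp only [← Finset.mul_sum]
    refine (mul_le_mul_of_nonneg_left (gain_edge x ω e) (wt_nonneg h0 h1 ω)).trans ?_
    split_ifs
    · simp
    · exact le_rfl

lemma reach_iso (φ : G ≃g G) (ω : G.edgeSet → Bool) (x y : V) :
    (occupied G (fun e => ω (φ.mapEdgeSet e))).Reachable x y ↔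
      (occupied G ω).Reachable (φ x) (φ y) := by
  let ψ : (occupied G (fun e => ω (φ.mapEdgeSet e))) ≃g occupied G ω :=
    { toEquiv := φ.toEquiv
      map_rel_iff' := by
        intro a b
        refine (occupied_adj G ω _ _).trans (Iff.trans ?_ (occupied_adj G _ a b).symm)
        constructor
        · rintro ⟨h1, h2⟩
          exact ⟨φ.map_adj_iff.1 h1, h2⟩
        · rintro ⟨h1, h2⟩
          exact ⟨φ.map_adj_iff.2 h1, h2⟩ }
  exact (SimpleGraph.Iso.reachable_iff (φ := ψ)).symm

lemma tau_iso (p : ℝ) (φ : G ≃g G) (x y : V) : tau G p (φ x) (φ y) = tau G p x y := by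
  rw [tau_evC, tau_evC, sum_ite_mul_wt, sum_ite_mul_wt]
  refine Fintype.sum_equiv (Equiv.arrowCongr φ.mapEdgeSet.symm (Equiv.refl Bool)) _ _ ?_
  intro ω
  have h : (Equiv.arrowCongr φ.mapEdgeSet.symm (Equiv.refl Bool)) ω =
      fun e => ω (φ.mapEdgeSet e) := by
    funext e; simp [Equiv.arrowCongr]
  rw [h]
  congr 1
  · unfold wt
    exact (Fintype.prod_equiv φ.mapEdgeSet _ _ (fun e => rfl)).symm
  · have h2 : evC (G := G) (φ x) (φ y) ω ↔ evC (G := G) x y (fun e => ω (φ.mapEdgeSet e)) :=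
      (reach_iso φ ω x y).symm
    simp only [h2]

lemma chi_const (ht : IsTransitive G) (p : ℝ) (x y : V) : chi G x p = chi G y p := by
  obtain ⟨φ, rfl⟩ := ht x y
  rw [chi_eq, chi_eq, ← Equiv.sum_comp φ.toEquiv (fun z => tau G p (φ x) z)]
  apply Finset.sum_congr rfl
  intro z _
  exact (tau_iso p φ x z).symm

lemma pair_bound {p c : ℝ} (h0 : 0 ≤ p) (h1 : p ≤ 1) (hc : ∀ x, chi G x p = c) (u v : V) :
    c ^ 2 * (1 - triangle G p u v) ≤ ∑ x, ∑ y, prob G p (evD (G := G) x u v y) := by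
  have hrow : ∀ x, ∑ y, tau G p x y = c := fun x => by rw [← chi_eq, hc]
  have hcol : ∀ y, ∑ x, tau G p x y = c := fun y => by
    rw [← hrow y]; exact Finset.sum_congr rfl fun x _ => tau_symm p x y
  have step : ∀ x y, tau G p x u * tau G p v y -
      ∑ w, ∑ z, (tau G p x z * (tau G p z u * tau G p z w)) * (tau G p v w * tau G p w y) ≤
      prob G p (evD (G := G) x u v y) := by
    intro x y
    have hl := lower (G := G) h0 h1 x u v y
    have : ∑ w, prob G p (evX (G := G) x u w) * (tau G p v w * tau G p w y) ≤
        ∑ w, ∑ z, (tau G p x z * (tau G p z u * tau G p z w)) *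
          (tau G p v w * tau G p w y) := by
      apply Finset.sum_le_sum
      intro w _
      rw [← Finset.sum_mul]
      exact mul_le_mul_of_nonneg_right (tree_graph h0 h1 x u w)
        (mul_nonneg (tau_nonneg h0 h1 _ _) (tau_nonneg h0 h1 _ _))
    linarith
  refine le_trans (le_of_eq ?_) (Finset.sum_le_sum fun x _ => Finset.sum_le_sum fun y _ => step x y)
  simp only [Finset.sum_sub_distrib]
  have t1 : ∑ x, ∑ y, tau G p x u * tau G p v y = c ^ 2 := by
    rw [← Finset.sum_mul_sum, hcol, hrow, sq]
  have t2 : ∑ x, ∑ y, ∑ w, ∑ z, (tau G p x z * (tau G p z u * tau G p z w)) *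
      (tau G p v w * tau G p w y) = c ^ 2 * triangle G p u v := by
    calc ∑ x, ∑ y, ∑ w, ∑ z, (tau G p x z * (tau G p z u * tau G p z w)) *
          (tau G p v w * tau G p w y)
        = ∑ x, ∑ w, ∑ z, ∑ y, (tau G p x z * (tau G p z u * tau G p z w)) *
          (tau G p v w * tau G p w y) := by
          apply Finset.sum_congr rfl; intro x _
          rw [Finset.sum_comm]
          apply Finset.sum_congr rfl; intro w _
          rw [Finset.sum_comm]
      _ = ∑ x, ∑ w, ∑ z, tau G p x z * (c * (tau G p z u * tau G p z w * tau G p v w)) := by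
          apply Finset.sum_congr rfl; intro x _
          apply Finset.sum_congr rfl; intro w _
          apply Finset.sum_congr rfl; intro z _
          rw [← Finset.mul_sum, ← Finset.mul_sum, hrow]
          ring
      _ = ∑ w, ∑ z, ∑ x, tau G p x z * (c * (tau G p z u * tau G p z w * tau G p v w)) := by
          rw [Finset.sum_comm]
          apply Finset.sum_congr rfl; intro w _
          rw [Finset.sum_comm]
      _ = ∑ w, ∑ z, c ^ 2 * (tau G p u z * tau G p z w * tau G p w v) := by
          apply Finset.sum_congr rfl; intro w _
          apply Finset.sum_congr rfl; intro z _
          rw [← Finset.sum_mul, hcol, tau_symm p z u, tau_symm p v w]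
          ring
      _ = c ^ 2 * triangle G p u v := by
          unfold triangle
          rw [Finset.sum_comm]
          simp only [← Finset.mul_sum]
  rw [t1, t2]
  ring

lemma chi_diff (ht : IsTransitive G) {Ω : ℕ}
    (hdeg : ∀ u, ∑ v, (if G.Adj u v then (1 : ℝ) else 0) = Ω) {p a₀ : ℝ} (h0 : 0 ≤ p)
    (h1 : p < 1) (ha : a₀ < 1) (htri : ∀ u v, G.Adj u v → triangle G p u v ≤ a₀) (x₀ : V) :
    ∃ D, HasDerivAt (chi G x₀) D p ∧ Ω * (1 - a₀) * chi G x₀ p ^ 2 ≤ D := by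
  obtain ⟨D, hD, _⟩ := chi_deriv (G := G) h0 h1.le x₀
  refine ⟨D, hD, ?_⟩
  have hall : ∀ x, ∑ u, ∑ v, (if G.Adj u v then ∑ y, prob G p (evD (G := G) x u v y) else 0) ≤
      (1 - p) * D := by
    intro x
    obtain ⟨D', hD', hle⟩ := chi_deriv (G := G) h0 h1.le x
    have : chi G x = chi G x₀ := funext fun q => chi_const ht q x x₀
    rw [this] at hD'
    rwa [hD'.unique hD] at hle
  have hsum := Finset.sum_le_sum fun x (_ : x ∈ (Finset.univ : Finset V)) => hall x
  rw [Finset.sum_const, Finset.card_univ, nsmul_eq_mul] at hsum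
  have hlow : (Fintype.card V : ℝ) * (Ω * (1 - a₀) * chi G x₀ p ^ 2) ≤
      ∑ x, ∑ u, ∑ v, (if G.Adj u v then ∑ y, prob G p (evD (G := G) x u v y) else 0) := by
    have e : ∑ x, ∑ u, ∑ v, (if G.Adj u v then ∑ y, prob G p (evD (G := G) x u v y) else 0) =
        ∑ u, ∑ v, ∑ x, (if G.Adj u v then ∑ y, prob G p (evD (G := G) x u v y) else 0) := by
      rw [Finset.sum_comm]
      apply Finset.sum_congr rfl; intro u _
      rw [Finset.sum_comm]
    rw [e]
    have e2 : (Fintype.card V : ℝ) * (Ω * (1 - a₀) * chi G x₀ p ^ 2) =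
        ∑ u : V, ∑ v : V, (if G.Adj u v then (1 : ℝ) else 0) * (chi G x₀ p ^ 2 * (1 - a₀)) := by
      simp only [← Finset.sum_mul, hdeg]
      rw [Finset.sum_const, Finset.card_univ, nsmul_eq_mul]
      ring
    rw [e2]
    apply Finset.sum_le_sum; intro u _
    apply Finset.sum_le_sum; intro v _
    by_cases h : G.Adj u v
    · simp only [h, if_true, one_mul]
      refine le_trans ?_ (pair_bound h0 h1.le (fun x => chi_const ht p x x₀) u v)
      exact mul_le_mul_of_nonneg_left (by linarith [htri u v h]) (sq_nonneg _)
    · simp [h]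
  have hV : 0 < (Fintype.card V : ℝ) := by
    have : Nonempty V := ⟨x₀⟩
    exact_mod_cast Fintype.card_pos
  have h3 : Ω * (1 - a₀) * chi G x₀ p ^ 2 ≤ (1 - p) * D :=
    le_of_mul_le_mul_left (hlow.trans hsum) hV
  have h4 : 0 ≤ (Ω : ℝ) * (1 - a₀) * chi G x₀ p ^ 2 :=
    mul_nonneg (mul_nonneg (Nat.cast_nonneg _) (by linarith)) (sq_nonneg _)
  have h5 : 0 ≤ D := nonneg_of_mul_nonneg_right (h4.trans h3) (by linarith)
  nlinarith

end Graph

end PercAux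

open Percolation in
/-- Theorem 1.1(i) of Borgs–Chayes–van der Hofstad–Slade–Spencer:
bounds on the critical threshold under the triangle condition. -/
theorem critical_threshold_bounds
    {V : Type*} [Fintype V] [DecidableEq V]
    (G : SimpleGraph V) [DecidableRel G.Adj]
    (hconn : G.Connected) (htrans : IsTransitive G)
    (Ω : ℕ) (hreg : G.IsRegularOfDegree Ω)
    (x₀ : V)
    (lam : ℝ) (hlam : 0 < lam)
    (hlamV : 1 < lam * (Fintype.card V : ℝ) ^ ((1 : ℝ) / 3))
    (hlamV' : lam * (Fintype.card V : ℝ) ^ ((1 : ℝ) / 3) < (Fintype.card V : ℝ))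
    (pc : ℝ) (hpc0 : 0 < pc) (hpc1 : pc < 1)
    (hpc : chi G x₀ pc = lam * (Fintype.card V : ℝ) ^ ((1 : ℝ) / 3))
    (a₀ : ℝ) (ha₀ : a₀ < 1)
    (htri : ∀ x y : V, triangle G pc x y ≤ kron x y + a₀) :
    1 - 1 / chi G x₀ pc ≤ (Ω : ℝ) * pc ∧
      (Ω : ℝ) * pc ≤ (1 - 1 / chi G x₀ pc) / (1 - a₀) := by
  have hdeg : ∀ u, ∑ v, (if G.Adj u v then (1 : ℝ) else 0) = Ω := by
    intro u
    rw [Finset.sum_boole, ← hreg.degree_eq u, ← SimpleGraph.card_neighborFinset_eq_degree]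
    congr 2
    ext v
    simp
  have hchi : 1 ≤ chi G x₀ pc := PercAux.chi_ge_one hpc0.le hpc1.le x₀
  have hpos : 0 < chi G x₀ pc := by linarith
  constructor
  · have h := PercAux.chi_first (G := G) hpc0.le hpc1.le x₀
    have e : ∑ u, (if G.Adj x₀ u then pc else 0) * chi G u pc = Ω * pc * chi G x₀ pc := by
      rw [← hdeg x₀, Finset.sum_mul, Finset.sum_mul]
      apply Finset.sum_congr rfl
      intro u _
      rw [PercAux.chi_const htrans pc u x₀]
      split_ifs <;> ring
    have h' : chi G x₀ pc ≤ 1 + Ω * pc * chi G x₀ pc := by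
      rw [← e]
      convert h
    rw [sub_le_iff_le_add, ← sub_le_iff_le_add', le_div_iff₀ hpos]
    linarith
  · have ha : 0 < 1 - a₀ := by linarith
    have hd : ∀ q ∈ Set.Icc 0 pc, ∃ D, HasDerivAt (chi G x₀) D q ∧
        Ω * (1 - a₀) * chi G x₀ q ^ 2 ≤ D := by
      intro q hq
      apply PercAux.chi_diff htrans (fun u => by convert hdeg u) hq.1 (by linarith [hq.2]) ha₀
      intro u v huv
      refine (PercAux.triangle_mono hq.1 hq.2 hpc1.le u v).trans ((htri u v).trans ?_)
      simp [kron, huv.ne]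
    have hge : ∀ q ∈ Set.Icc 0 pc, 1 ≤ chi G x₀ q := fun q hq =>
      PercAux.chi_ge_one hq.1 (by linarith [hq.2]) x₀
    have hd2 : ∀ q ∈ Set.Icc 0 pc, ∃ D, 0 ≤ D ∧
        HasDerivAt (fun t => -(chi G x₀ t)⁻¹ - Ω * (1 - a₀) * t) D q := by
      intro q hq
      obtain ⟨D, h1, h2⟩ := hd q hq
      have hp : 0 < chi G x₀ q := by linarith [hge q hq]
      refine ⟨_, ?_, ((h1.fun_inv hp.ne').neg).sub ((hasDerivAt_id' q).const_mul _)⟩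
      rw [mul_one, neg_div, neg_neg, sub_nonneg, le_div_iff₀ (by positivity)]
      exact h2
    have hm : MonotoneOn (fun t => -(chi G x₀ t)⁻¹ - Ω * (1 - a₀) * t) (Set.Icc 0 pc) := by
      apply monotoneOn_of_deriv_nonneg (convex_Icc 0 pc)
      · intro q hq
        obtain ⟨D, _, h⟩ := hd2 q hq
        exact h.continuousAt.continuousWithinAt
      · intro q hq
        obtain ⟨D, _, h⟩ := hd2 q (interior_subset hq)
        exact h.differentiableAt.differentiableWithinAt
      · intro q hq
        obtain ⟨D, h0, h⟩ := hd2 q (interior_subset hq)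
        rw [h.deriv]
        exact h0
    have h := hm ⟨le_rfl, hpc0.le⟩ ⟨hpc0.le, le_rfl⟩ hpc0.le
    simp only [mul_zero, sub_zero] at h
    have h1 : (chi G x₀ 0)⁻¹ ≤ 1 := inv_le_one_of_one_le₀ (hge 0 ⟨le_rfl, hpc0.le⟩)
    rw [le_div_iff₀ ha, one_div]
    linarith
end
end

section
/- Let 𝔾 be a finite connected transitive graph, λ > 0 with 1 < λV^{1/3} < V, and suppose the triangle condition ∇_{p_c}(x,y) ≤ δ_{x,y} + a₀ holds for all vertices x, y with some constant a₀ < 1. Then for every p of the form p = p_c − Ω^{-1}ε with ε ≥ 0 (and p ≥ 0), the susceptibility satisfies 1/(ε₀ + ε) ≤ χ(p) ≤ 1/(ε₀ + (1 − a₀)ε). -/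
noncomputable section
open Classical

namespace PercAux

/-- Indicator of a proposition. -/
def ind (P : Prop) : ℝ := if P then 1 else 0

theorem ind_true {P : Prop} (h : P) : ind P = 1 := by simp [ind, h]
theorem ind_false {P : Prop} (h : ¬ P) : ind P = 0 := by simp [ind, h]
theorem ind_nonneg (P : Prop) : 0 ≤ ind P := by unfold ind; split_ifs <;> norm_num
theorem ind_le_one (P : Prop) : ind P ≤ 1 := by unfold ind; split_ifs <;> norm_num
theorem ind_mono {P Q : Prop} (h : P → Q) : ind P ≤ ind Q := by
  by_cases hP : P
  · rw [ind_true hP, ind_true (h hP)]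
  · rw [ind_false hP]; exact ind_nonneg _
theorem ind_congr {P Q : Prop} (h : P ↔ Q) : ind P = ind Q := by rw [propext h]
theorem ind_and (P Q : Prop) : ind (P ∧ Q) = ind P * ind Q := by
  by_cases hP : P <;> by_cases hQ : Q <;> simp [ind, hP, hQ]

section Gen
variable {E : Type*} [DecidableEq E]

/-- Expectation of `f` for percolation on the edge set `s`. -/
def W (p : ℝ) (s : Finset E) (f : Finset E → ℝ) : ℝ :=
  ∑ t ∈ s.powerset, p ^ t.card * (1 - p) ^ (s \ t).card * f t

theorem W_empty (p : ℝ) (f : Finset E → ℝ) : W p ∅ f = f ∅ := by simp [W]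

theorem W_insert (p : ℝ) {s : Finset E} {a : E} (ha : a ∉ s) (f : Finset E → ℝ) :
    W p (insert a s) f = (1 - p) * W p s f + p * W p s (fun t => f (insert a t)) := by
  unfold W
  rw [Finset.sum_powerset_insert ha, Finset.mul_sum, Finset.mul_sum]
  congr 1
  · refine Finset.sum_congr rfl fun t ht => ?_
    have hat : a ∉ t := fun h => ha (Finset.mem_powerset.1 ht h)
    rw [Finset.insert_sdiff_of_notMem _ hat, Finset.card_insert_of_notMem (by simp [ha])]
    ring
  · refine Finset.sum_congr rfl fun t ht => ?_
    have hat : a ∉ t := fun h => ha (Finset.mem_powerset.1 ht h)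
    have : insert a s \ insert a t = s \ t := by
      ext x; simp only [Finset.mem_sdiff, Finset.mem_insert]
      constructor
      · rintro ⟨h1 | h1, h2⟩ <;> tauto
      · rintro ⟨h1, h2⟩
        refine ⟨Or.inr h1, ?_⟩
        rintro (rfl | h)
        · exact ha h1
        · exact h2 h
    rw [this, Finset.card_insert_of_notMem hat]
    ring

theorem W_congr (p : ℝ) {s : Finset E} {f g : Finset E → ℝ} (h : ∀ t ⊆ s, f t = g t) :
    W p s f = W p s g := by
  unfold W
  exact Finset.sum_congr rfl fun t ht => by rw [h t (Finset.mem_powerset.1 ht)]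

theorem W_mono {p : ℝ} (hp0 : 0 ≤ p) (hp1 : p ≤ 1) {s : Finset E} {f g : Finset E → ℝ}
    (h : ∀ t ⊆ s, f t ≤ g t) : W p s f ≤ W p s g := by
  unfold W
  refine Finset.sum_le_sum fun t ht => ?_
  have : 0 ≤ 1 - p := by linarith
  exact mul_le_mul_of_nonneg_left (h t (Finset.mem_powerset.1 ht)) (by positivity)

theorem W_add (p : ℝ) (s : Finset E) (f g : Finset E → ℝ) :
    W p s (fun t => f t + g t) = W p s f + W p s g := by
  simp only [W, mul_add, Finset.sum_add_distrib]

theorem W_sub (p : ℝ) (s : Finset E) (f g : Finset E → ℝ) :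
    W p s (fun t => f t - g t) = W p s f - W p s g := by
  simp only [W, mul_sub, Finset.sum_sub_distrib]

theorem W_mul (p c : ℝ) (s : Finset E) (f : Finset E → ℝ) :
    W p s (fun t => c * f t) = c * W p s f := by
  simp only [W, Finset.mul_sum]
  exact Finset.sum_congr rfl fun t _ => by ring

theorem W_mul_right (p c : ℝ) (s : Finset E) (f : Finset E → ℝ) :
    W p s (fun t => f t * c) = W p s f * c := by
  simp only [W, Finset.sum_mul]
  exact Finset.sum_congr rfl fun t _ => by ring

theorem W_sum {ι : Type*} (p : ℝ) (s : Finset E) (I : Finset ι) (f : ι → Finset E → ℝ) :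
    W p s (fun t => ∑ i ∈ I, f i t) = ∑ i ∈ I, W p s (f i) := by
  simp only [W, Finset.mul_sum]
  exact Finset.sum_comm

theorem W_const (p c : ℝ) (s : Finset E) : W p s (fun _ => c) = c := by
  induction s using Finset.induction_on with
  | empty => simp [W]
  | insert a s ha ih => rw [W_insert p ha, ih]; ring

theorem W_nonneg {p : ℝ} (hp0 : 0 ≤ p) (hp1 : p ≤ 1) {s : Finset E} {f : Finset E → ℝ}
    (h : ∀ t ⊆ s, 0 ≤ f t) : 0 ≤ W p s f := by
  have := W_mono hp0 hp1 h
  rwa [W_const] at this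

theorem W_mono_p {p q : ℝ} (hp0 : 0 ≤ p) (hpq : p ≤ q) (hq : q ≤ 1) (s : Finset E) :
    ∀ (f : Finset E → ℝ), Monotone f → W p s f ≤ W q s f := by
  induction s using Finset.induction_on with
  | empty => intro f _; simp [W]
  | insert a s ha ih =>
    intro f hf
    rw [W_insert p ha, W_insert q ha]
    have h0 := ih f hf
    have h1 := ih (fun t => f (insert a t)) (fun x y h => hf (Finset.insert_subset_insert a h))
    have h2 : W q s f ≤ W q s (fun t => f (insert a t)) :=
      W_mono (hp0.trans hpq) hq fun t _ => hf (Finset.subset_insert a t)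
    have h3 : 0 ≤ 1 - p := by linarith
    nlinarith [mul_le_mul_of_nonneg_left h0 h3, mul_le_mul_of_nonneg_left h1 hp0,
      mul_nonneg (sub_nonneg.2 hpq) (sub_nonneg.2 h2)]

theorem W_erase_le {p : ℝ} (hp0 : 0 ≤ p) (hp1 : p ≤ 1) {s : Finset E} {a : E} (ha : a ∈ s)
    {f : Finset E → ℝ} (hf : Monotone f) : W p (s.erase a) f ≤ W p s f := by
  conv_rhs => rw [← Finset.insert_erase ha, W_insert p (Finset.notMem_erase a s)]
  have h2 : W p (s.erase a) f ≤ W p (s.erase a) (fun t => f (insert a t)) :=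
    W_mono hp0 hp1 fun t _ => hf (Finset.subset_insert a t)
  nlinarith

/-- Russo's formula. -/
theorem W_deriv (p : ℝ) (s : Finset E) : ∀ (f : Finset E → ℝ),
    HasDerivAt (fun q => W q s f)
      (∑ e ∈ s, W p (s.erase e) (fun t => f (insert e t) - f t)) p := by
  induction s using Finset.induction_on with
  | empty => intro f; simpa [W] using hasDerivAt_const p (f ∅)
  | insert a s ha ih =>
    intro f
    have h := (((hasDerivAt_id p).const_sub 1).mul (ih f)).add
      ((hasDerivAt_id p).mul (ih (fun t => f (insert a t))))
    have hfun : (fun q => W q (insert a s) f) =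
        ((fun q => 1 - id q) * (fun q => W q s f) + id * (fun q => W q s fun t => f (insert a t))) := by
      funext q; simp [W_insert q ha]
    rw [hfun]
    refine h.congr_deriv ?_
    rw [Finset.sum_insert ha, Finset.erase_insert ha, W_sub]
    have : ∀ e ∈ s, W p ((insert a s).erase e) (fun t => f (insert e t) - f t) =
        (1 - p) * W p (s.erase e) (fun t => f (insert e t) - f t) +
        p * W p (s.erase e) (fun t => f (insert a (insert e t)) - f (insert a t)) := by
      intro e he
      have hne : a ≠ e := fun h => ha (h ▸ he)
      rw [Finset.erase_insert_of_ne hne, W_insert p (by simp [ha])]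
      simp only [Finset.insert_comm e a]
    rw [Finset.sum_congr rfl this, Finset.sum_add_distrib, ← Finset.mul_sum, ← Finset.mul_sum]
    simp only [id]
    ring

/-- Independence. -/
theorem W_indep (p : ℝ) (s : Finset E) : ∀ (f g : Finset E → ℝ),
    (∀ e, (∀ t, f (insert e t) = f t) ∨ (∀ t, g (insert e t) = g t)) →
    W p s (fun t => f t * g t) = W p s f * W p s g := by
  induction s using Finset.induction_on with
  | empty => intro f g _; simp [W]
  | insert a s ha ih =>
    intro f g h
    rw [W_insert p ha, W_insert p ha, W_insert p ha, ih f g h]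
    rcases h a with h1 | h1
    · simp only [h1]
      rw [ih f (fun t => g (insert a t))]
      · ring
      · intro e
        refine (h e).imp id fun h2 t => ?_
        rw [Finset.insert_comm, h2]
    · simp only [h1]
      rw [ih (fun t => f (insert a t)) g]
      · ring
      · intro e
        refine (h e).imp (fun h2 t => ?_) id
        rw [Finset.insert_comm, h2]

theorem W_image (p : ℝ) (σ : E ≃ E) (s : Finset E) : ∀ (f : Finset E → ℝ),
    W p (s.image σ) f = W p s (fun t => f (t.image σ)) := by
  induction s using Finset.induction_on with
  | empty => intro f; simp [W]
  | insert a s ha ih =>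
    intro f
    rw [Finset.image_insert, W_insert p (by simpa using ha), W_insert p ha, ih, ih]
    simp only [Finset.image_insert]

/-- A general form of the van den Berg--Kesten inequality. -/
theorem BK_gen {p : ℝ} (hp0 : 0 ≤ p) (hp1 : p ≤ 1) (s : Finset E) :
    ∀ (R : Finset E → Finset E → Prop),
    W p s (fun ω => ind (∃ S T, R S T ∧ S ⊆ ω ∧ T ⊆ ω ∧ Disjoint S T)) ≤
      W p s (fun ω => W p s (fun ω' => ind (∃ S T, R S T ∧ S ⊆ ω ∧ T ⊆ ω'))) := by
  induction s using Finset.induction_on with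
  | empty =>
    intro R
    simp only [W_empty]
    refine ind_mono ?_
    rintro ⟨S, T, h, h1, h2, -⟩
    exact ⟨S, T, h, h1, h2⟩
  | insert a s ha ih =>
    intro R
    let Q : Finset E → Finset E → Prop := fun S T => ∃ S' T', R S' T' ∧ ¬ (a ∈ S' ∧ a ∈ T') ∧
      S = S'.erase a ∧ T = T'.erase a
    let g : Finset E → Finset E → ℝ := fun ω ω' => ind (∃ S T, R S T ∧ S ⊆ ω ∧ T ⊆ ω')
    have hQ : W p s (fun ω => ind (∃ S T, R S T ∧ S ⊆ insert a ω ∧ T ⊆ insert a ω ∧ Disjoint S T))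
        ≤ W p s (fun ω => W p s (fun ω' => ind (∃ S T, Q S T ∧ S ⊆ ω ∧ T ⊆ ω'))) := by
      refine le_trans (W_mono hp0 hp1 fun ω _ => ind_mono ?_) (ih Q)
      rintro ⟨S, T, h, h1, h2, h3⟩
      refine ⟨S.erase a, T.erase a, ⟨S, T, h, ?_, rfl, rfl⟩, ?_, ?_, ?_⟩
      · rintro ⟨h4, h5⟩
        exact Finset.disjoint_left.1 h3 h4 h5
      · exact Finset.subset_insert_iff.1 h1
      · exact Finset.subset_insert_iff.1 h2
      · exact h3.mono (Finset.erase_subset _ _) (Finset.erase_subset _ _)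
    have hR := ih R
    have h1p : 0 ≤ 1 - p := by linarith
    have step : W p s (fun ω => W p s (fun ω' => (1 - p) * g ω ω' +
          p * ind (∃ S T, Q S T ∧ S ⊆ ω ∧ T ⊆ ω')))
        ≤ W p s (fun ω => W p s (fun ω' => (1 - p) * ((1 - p) * g ω ω' + p * g ω (insert a ω')) +
          p * ((1 - p) * g (insert a ω) ω' + p * g (insert a ω) (insert a ω')))) := by
      refine W_mono hp0 hp1 fun ω hω => W_mono hp0 hp1 fun ω' hω' => ?_
      have m1 : g ω ω' ≤ g ω (insert a ω') := ind_mono fun ⟨S, T, h, h1, h2⟩ =>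
        ⟨S, T, h, h1, h2.trans (Finset.subset_insert _ _)⟩
      have m2 : g ω ω' ≤ g (insert a ω) ω' := ind_mono fun ⟨S, T, h, h1, h2⟩ =>
        ⟨S, T, h, h1.trans (Finset.subset_insert _ _), h2⟩
      have m3 : g ω (insert a ω') ≤ g (insert a ω) (insert a ω') := ind_mono
        fun ⟨S, T, h, h1, h2⟩ => ⟨S, T, h, h1.trans (Finset.subset_insert _ _), h2⟩
      have m4 : g (insert a ω) ω' ≤ g (insert a ω) (insert a ω') := ind_mono
        fun ⟨S, T, h, h1, h2⟩ => ⟨S, T, h, h1, h2.trans (Finset.subset_insert _ _)⟩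
      have n1 : 0 ≤ g ω ω' := ind_nonneg _
      have n2 : g (insert a ω) (insert a ω') ≤ 1 := ind_le_one _
      by_cases hq : ∃ S T, Q S T ∧ S ⊆ ω ∧ T ⊆ ω'
      · rw [ind_true hq]
        obtain ⟨S, T, ⟨S', T', h, h1, rfl, rfl⟩, h2, h3⟩ := hq
        have h2' := Finset.subset_insert_iff.2 h2
        have h3' := Finset.subset_insert_iff.2 h3
        have : g ω (insert a ω') = 1 ∨ g (insert a ω) ω' = 1 := by
          by_cases haS : a ∈ S'
          · have haT : a ∉ T' := fun h => h1 ⟨haS, h⟩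
            right
            rw [Finset.erase_eq_of_notMem haT] at h3
            exact ind_true ⟨S', T', h, h2', h3⟩
          · left
            rw [Finset.erase_eq_of_notMem haS] at h2
            exact ind_true ⟨S', T', h, h2, h3'⟩
        have hpp := mul_nonneg hp0 h1p
        rcases this with h5 | h5
        · have h6 : g (insert a ω) (insert a ω') = 1 := le_antisymm n2 (h5 ▸ m3)
          rw [h5, h6]
          nlinarith [mul_le_mul_of_nonneg_left m2 hpp]
        · have h6 : g (insert a ω) (insert a ω') = 1 := le_antisymm n2 (h5 ▸ m4)
          rw [h5, h6]
          nlinarith [mul_le_mul_of_nonneg_left m1 hpp]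
      · rw [ind_false hq]
        have hpp := mul_nonneg hp0 h1p
        nlinarith [mul_le_mul_of_nonneg_left m1 hpp, mul_nonneg hpp (n1.trans m2),
          mul_nonneg (mul_nonneg hp0 hp0) (n1.trans (m1.trans m3))]
    rw [W_insert p ha, W_insert p ha]
    simp only [W_insert p ha]
    simp only [W_add, W_mul] at step ⊢
    have e1 := mul_le_mul_of_nonneg_left hR h1p
    have e2 := mul_le_mul_of_nonneg_left hQ hp0
    linarith

/-- The van den Berg--Kesten inequality for increasing events. -/
theorem BK {p : ℝ} (hp0 : 0 ≤ p) (hp1 : p ≤ 1) (s : Finset E) (A B : Finset E → Prop)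
    (hA : ∀ S T, S ⊆ T → A S → A T) (hB : ∀ S T, S ⊆ T → B S → B T) :
    W p s (fun ω => ind (∃ S T, S ⊆ ω ∧ T ⊆ ω ∧ Disjoint S T ∧ A S ∧ B T)) ≤
      W p s (fun ω => ind (A ω)) * W p s (fun ω => ind (B ω)) := by
  refine le_trans (W_mono hp0 hp1 fun ω _ => ind_mono ?_)
    ((BK_gen hp0 hp1 s (fun S T => A S ∧ B T)).trans ?_)
  · rintro ⟨S, T, h1, h2, h3, h4, h5⟩
    exact ⟨S, T, ⟨h4, h5⟩, h1, h2, h3⟩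
  · rw [← W_mul_right]
    refine W_mono hp0 hp1 fun ω _ => ?_
    rw [← W_mul]
    refine W_mono hp0 hp1 fun ω' _ => ?_
    rw [← ind_and]
    refine ind_mono ?_
    rintro ⟨S, T, ⟨h1, h2⟩, h3, h4⟩
    exact ⟨hA _ _ h3 h1, hB _ _ h4 h2⟩

end Gen
section Graph
variable {V : Type*}

/-- Connectivity by the edges in `ω`. -/
def Rc (ω : Finset (Sym2 V)) (x y : V) : Prop :=
  (SimpleGraph.fromEdgeSet (ω : Set (Sym2 V))).Reachable x y

theorem Rc_refl (ω : Finset (Sym2 V)) (x : V) : Rc ω x x := SimpleGraph.Reachable.refl x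
theorem Rc_symm {ω : Finset (Sym2 V)} {x y : V} (h : Rc ω x y) : Rc ω y x :=
  SimpleGraph.Reachable.symm h
theorem Rc_trans {ω : Finset (Sym2 V)} {x y z : V} (h : Rc ω x y) (h' : Rc ω y z) : Rc ω x z :=
  SimpleGraph.Reachable.trans h h'
theorem Rc_mono {S T : Finset (Sym2 V)} (h : S ⊆ T) {x y : V} (h' : Rc S x y) : Rc T x y :=
  SimpleGraph.Reachable.mono (SimpleGraph.fromEdgeSet_mono (by exact_mod_cast h)) h'

theorem Rc_of_walk {ω S : Finset (Sym2 V)} {x y : V}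
    (w : (SimpleGraph.fromEdgeSet (ω : Set (Sym2 V))).Walk x y) (h : ∀ e ∈ w.edges, e ∈ S) :
    Rc S x y :=
  ⟨w.transfer _ (fun e he => by
    have h1 := w.edges_subset_edgeSet he
    rw [SimpleGraph.edgeSet_fromEdgeSet] at h1 ⊢
    exact ⟨h e he, h1.2⟩)⟩

theorem mem_of_walk {ω : Finset (Sym2 V)} {x y : V}
    (w : (SimpleGraph.fromEdgeSet (ω : Set (Sym2 V))).Walk x y) {e : Sym2 V} (he : e ∈ w.edges) :
    e ∈ ω := by
  have h1 := w.edges_subset_edgeSet he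
  rw [SimpleGraph.edgeSet_fromEdgeSet] at h1
  exact h1.1

theorem Rc_insert [DecidableEq V] {ω : Finset (Sym2 V)} {u v o x : V}
    (h : Rc (insert s(u, v) ω) o x) :
    Rc ω o x ∨ (Rc ω o u ∧ Rc ω v x) ∨ (Rc ω o v ∧ Rc ω u x) := by
  obtain ⟨w⟩ := h
  induction w with
  | nil => exact Or.inl (Rc_refl _ _)
  | @cons o b x hadj w ih =>
    rw [SimpleGraph.fromEdgeSet_adj] at hadj
    obtain ⟨h1, h2⟩ := hadj
    rw [Finset.mem_coe, Finset.mem_insert] at h1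
    rcases h1 with h1 | h1
    · rcases Sym2.eq_iff.1 h1 with ⟨rfl, rfl⟩ | ⟨rfl, rfl⟩
      · rcases ih with h | ⟨_, h⟩ | ⟨_, h⟩
        · exact Or.inr (Or.inl ⟨Rc_refl _ _, h⟩)
        · exact Or.inr (Or.inl ⟨Rc_refl _ _, h⟩)
        · exact Or.inl h
      · rcases ih with h | ⟨_, h⟩ | ⟨_, h⟩
        · exact Or.inr (Or.inr ⟨Rc_refl _ _, h⟩)
        · exact Or.inl h
        · exact Or.inr (Or.inr ⟨Rc_refl _ _, h⟩)
    · have hob : Rc ω o b := SimpleGraph.Adj.reachable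
        ((SimpleGraph.fromEdgeSet_adj _).2 ⟨by exact_mod_cast h1, h2⟩)
      rcases ih with h | ⟨h', h⟩ | ⟨h', h⟩
      · exact Or.inl (Rc_trans hob h)
      · exact Or.inr (Or.inl ⟨Rc_trans hob h', h⟩)
      · exact Or.inr (Or.inr ⟨Rc_trans hob h', h⟩)

theorem Rc_edge [DecidableEq V] (ω : Finset (Sym2 V)) (u v : V) : Rc (insert s(u, v) ω) u v := by
  by_cases h : u = v
  · subst h; exact Rc_refl _ _
  · exact SimpleGraph.Adj.reachable ((SimpleGraph.fromEdgeSet_adj _).2 ⟨by simp, h⟩)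

/-- Disjoint occurrence of two connections. -/
def DC (ω : Finset (Sym2 V)) (A B : Finset (Sym2 V) → Prop) : Prop :=
  ∃ S T, S ⊆ ω ∧ T ⊆ ω ∧ Disjoint S T ∧ A S ∧ B T

theorem DC_of_not [DecidableEq V] {ω : Finset (Sym2 V)} {o u v x : V} (h1 : Rc ω o u)
    (h2 : Rc ω v x) (h3 : ¬ Rc ω o x) : DC ω (fun S => Rc S o u) (fun T => Rc T v x) := by
  obtain ⟨p⟩ := h1
  obtain ⟨q⟩ := h2
  refine ⟨p.edges.toFinset, q.edges.toFinset, ?_, ?_, ?_, ?_, ?_⟩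
  · intro e he; exact mem_of_walk p (List.mem_toFinset.1 he)
  · intro e he; exact mem_of_walk q (List.mem_toFinset.1 he)
  · rw [Finset.disjoint_left]
    intro e he he'
    rw [List.mem_toFinset] at he he'
    induction e using Sym2.ind with
    | _ a b =>
      have ha := p.fst_mem_support_of_mem_edges he
      have hb := q.fst_mem_support_of_mem_edges he'
      exact h3 (Rc_trans ⟨p.takeUntil a ha⟩ ⟨q.dropUntil a hb⟩)
  · exact Rc_of_walk p fun e he => List.mem_toFinset.2 he
  · exact Rc_of_walk q fun e he => List.mem_toFinset.2 he

theorem DC_path [DecidableEq V] {ω : Finset (Sym2 V)} {v x w : V}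
    (p : (SimpleGraph.fromEdgeSet (ω : Set (Sym2 V))).Walk v x) (hp : p.IsPath)
    (hw : w ∈ p.support) : ∃ S T, S ⊆ p.edges.toFinset ∧ T ⊆ p.edges.toFinset ∧ Disjoint S T ∧
      Rc S v w ∧ Rc T w x := by
  have hspec := p.take_spec hw
  have hnd : p.edges.Nodup := hp.isTrail.edges_nodup
  have hed : p.edges = (p.takeUntil w hw).edges ++ (p.dropUntil w hw).edges := by
    conv_lhs => rw [← hspec]
    rw [SimpleGraph.Walk.edges_append]
  refine ⟨(p.takeUntil w hw).edges.toFinset, (p.dropUntil w hw).edges.toFinset, ?_, ?_, ?_, ?_, ?_⟩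
  · intro e he; rw [hed]; simp at he ⊢; exact Or.inl he
  · intro e he; rw [hed]; simp at he ⊢; exact Or.inr he
  · rw [Finset.disjoint_left]
    intro e he he'
    rw [List.mem_toFinset] at he he'
    rw [hed] at hnd
    exact (List.nodup_append.1 hnd).2.2 e he e he' rfl
  · exact Rc_of_walk _ fun e he => List.mem_toFinset.2 he
  · exact Rc_of_walk _ fun e he => List.mem_toFinset.2 he

/-- Edges of `ω` not touching `A`. -/
def off (A : Finset V) (ω : Finset (Sym2 V)) : Finset (Sym2 V) :=
  ω.filter fun e => ∀ a ∈ A, a ∉ e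

theorem mem_off {A : Finset V} {ω : Finset (Sym2 V)} {e : Sym2 V} :
    e ∈ off A ω ↔ e ∈ ω ∧ ∀ a ∈ A, a ∉ e := by
  unfold off
  rw [Finset.mem_filter]

theorem through [DecidableEq V] {ω : Finset (Sym2 V)} {v x : V} (A : Finset V) (h : Rc ω v x) :
    (v ∉ A ∧ Rc (off A ω) v x) ∨ ∃ w ∈ A, DC ω (fun S => Rc S v w) (fun T => Rc T w x) := by
  obtain ⟨p, hp⟩ := h.exists_isPath
  by_cases hA : ∃ w ∈ A, w ∈ p.support
  · obtain ⟨w, hw, hws⟩ := hA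
    right
    obtain ⟨S, T, h1, h2, h3, h4, h5⟩ := DC_path p hp hws
    have hsub : p.edges.toFinset ⊆ ω := fun e he => mem_of_walk p (List.mem_toFinset.1 he)
    exact ⟨w, hw, S, T, h1.trans hsub, h2.trans hsub, h3, h4, h5⟩
  · push Not at hA
    left
    refine ⟨fun hv => hA v hv p.start_mem_support, Rc_of_walk p fun e he => ?_⟩
    refine mem_off.2 ⟨mem_of_walk p he, fun a ha hae => hA a ha ?_⟩
    obtain ⟨b, rfl⟩ := Sym2.mem_iff_exists.1 hae
    exact p.fst_mem_support_of_mem_edges he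

theorem first_hit [DecidableEq V] {ω : Finset (Sym2 V)} {o u w y : V}
    (q : (SimpleGraph.fromEdgeSet (ω : Set (Sym2 V))).Walk o u)
    (r : (SimpleGraph.fromEdgeSet (ω : Set (Sym2 V))).Walk w y) (hy : y ∈ q.support) :
    ∃ z ∈ q.support, ∃ T, T ⊆ ω ∧ Disjoint T q.edges.toFinset ∧ Rc T w z := by
  induction r with
  | nil => exact ⟨_, hy, ∅, by simp, by simp, Rc_refl _ _⟩
  | @cons w b y hadj r ih =>
    by_cases hw : w ∈ q.support
    · exact ⟨w, hw, ∅, by simp, by simp, Rc_refl _ _⟩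
    · obtain ⟨z, hz, T, h1, h2, h3⟩ := ih hy
      have hadj' := (SimpleGraph.fromEdgeSet_adj _).1 hadj
      refine ⟨z, hz, insert s(w, b) T, ?_, ?_, ?_⟩
      · exact Finset.insert_subset (by exact_mod_cast hadj'.1) h1
      · rw [Finset.disjoint_insert_left]
        refine ⟨fun h => hw ?_, h2⟩
        exact q.fst_mem_support_of_mem_edges (List.mem_toFinset.1 h)
      · exact Rc_trans (Rc_edge T w b) (Rc_mono (Finset.subset_insert _ _) h3)

theorem tree [DecidableEq V] {ω : Finset (Sym2 V)} {o u w : V} (h1 : Rc ω o u) (h2 : Rc ω o w) :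
    ∃ z, DC ω (fun S => Rc S o z) (fun T => DC T (fun S => Rc S z u) (fun S => Rc S z w)) := by
  obtain ⟨q, hq⟩ := h1.exists_isPath
  obtain ⟨r⟩ := Rc_symm h2
  obtain ⟨z, hz, R, hR, hd, hRc⟩ := first_hit q r q.start_mem_support
  obtain ⟨S, T, hS, hT, hST, h3, h4⟩ := DC_path q hq hz
  have hsub : q.edges.toFinset ⊆ ω := fun e he => mem_of_walk q (List.mem_toFinset.1 he)
  refine ⟨z, S, T ∪ R, hS.trans hsub, Finset.union_subset (hT.trans hsub) hR, ?_, h3, ?_⟩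
  · exact Finset.disjoint_union_right.2 ⟨hST, (hd.mono_right hS).symm⟩
  · exact ⟨T, R, Finset.subset_union_left, Finset.subset_union_right, (hd.mono_right hT).symm, h4,
      Rc_symm hRc⟩

end Graph

section Graph2
variable {V : Type*} [Fintype V] [DecidableEq V]

/-- The cluster of `o`. -/
def Cl (ω : Finset (Sym2 V)) (o : V) : Finset V := Finset.univ.filter fun y => Rc ω o y

theorem mem_Cl {ω : Finset (Sym2 V)} {o y : V} : y ∈ Cl ω o ↔ Rc ω o y := by simp [Cl]

theorem Cl_insert_of {ω : Finset (Sym2 V)} {o : V} {e : Sym2 V}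
    (he : ∀ a ∈ Cl ω o, a ∉ e) : Cl (insert e ω) o = Cl ω o := by
  induction e using Sym2.ind with
  | _ u v =>
    ext y
    rw [mem_Cl, mem_Cl]
    refine ⟨fun h => ?_, Rc_mono (Finset.subset_insert _ _)⟩
    rcases Rc_insert h with h | ⟨h, _⟩ | ⟨h, _⟩
    · exact h
    · exact absurd (Sym2.mem_mk_left u v) (he u (mem_Cl.2 h))
    · exact absurd (Sym2.mem_mk_right u v) (he v (mem_Cl.2 h))

theorem Cl_insert_iff {ω : Finset (Sym2 V)} {o : V} {e : Sym2 V} {A : Finset V}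
    (he : ∀ a ∈ A, a ∉ e) : Cl (insert e ω) o = A ↔ Cl ω o = A := by
  constructor
  · rintro rfl
    refine (Cl_insert_of fun a ha => he a ?_).symm
    exact mem_Cl.2 (Rc_mono (Finset.subset_insert _ _) (mem_Cl.1 ha))
  · rintro rfl
    exact Cl_insert_of he

/-- Two-point function on the edge set `s`. -/
def T (p : ℝ) (s : Finset (Sym2 V)) (x y : V) : ℝ := W p s (fun ω => ind (Rc ω x y))

theorem T_symm (p : ℝ) (s : Finset (Sym2 V)) (x y : V) : T p s x y = T p s y x :=
  W_congr p fun _ _ => ind_congr ⟨Rc_symm, Rc_symm⟩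

theorem T_nonneg {p : ℝ} (hp0 : 0 ≤ p) (hp1 : p ≤ 1) (s : Finset (Sym2 V))
    (x y : V) : 0 ≤ T p s x y := W_nonneg hp0 hp1 fun _ _ => ind_nonneg _

theorem T_DC {p : ℝ} (hp0 : 0 ≤ p) (hp1 : p ≤ 1) (s : Finset (Sym2 V))
    (a b c d : V) :
    W p s (fun ω => ind (DC ω (fun S => Rc S a b) (fun S => Rc S c d))) ≤ T p s a b * T p s c d :=
  BK hp0 hp1 s _ _ (fun _ _ h h' => Rc_mono h h') (fun _ _ h h' => Rc_mono h h')

theorem T_tree {p : ℝ} (hp0 : 0 ≤ p) (hp1 : p ≤ 1) (s : Finset (Sym2 V))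
    (o u w : V) :
    W p s (fun ω => ind (Rc ω o u ∧ Rc ω o w)) ≤ ∑ z, T p s o z * (T p s z u * T p s z w) := by
  calc _ ≤ W p s (fun ω => ∑ z, ind (DC ω (fun S => Rc S o z)
        (fun T => DC T (fun S => Rc S z u) (fun S => Rc S z w)))) := by
        refine W_mono hp0 hp1 fun ω _ => ?_
        by_cases h : Rc ω o u ∧ Rc ω o w
        · rw [ind_true h]
          obtain ⟨z, hz⟩ := tree h.1 h.2
          rw [← ind_true hz]
          exact Finset.single_le_sum (f := fun z => ind (DC ω (fun S => Rc S o z)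
            (fun T => DC T (fun S => Rc S z u) (fun S => Rc S z w))))
            (fun z _ => ind_nonneg _) (Finset.mem_univ z)
        · rw [ind_false h]
          exact Finset.sum_nonneg fun z _ => ind_nonneg _
    _ ≤ _ := by
        rw [W_sum]
        refine Finset.sum_le_sum fun z _ => ?_
        refine (BK hp0 hp1 s (fun S => Rc S o z)
          (fun T => DC T (fun S => Rc S z u) (fun S => Rc S z w))
          (fun _ _ h h' => Rc_mono h h') ?_).trans ?_
        · rintro S T h ⟨A, B, h1, h2, h3⟩
          exact ⟨A, B, h1.trans h, h2.trans h, h3⟩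
        · exact mul_le_mul_of_nonneg_left (T_DC hp0 hp1 s z u z w) (T_nonneg hp0 hp1 s o z)

theorem T_off {p : ℝ} (hp0 : 0 ≤ p) (hp1 : p ≤ 1) (s : Finset (Sym2 V))
    (A : Finset V) (v x : V) :
    T p s v x - ∑ w, ind (w ∈ A) * (T p s v w * T p s w x) ≤
      W p s (fun ω => ind (v ∉ A ∧ Rc (off A ω) v x)) := by
  rw [sub_le_iff_le_add]
  calc T p s v x ≤ W p s (fun ω => ind (v ∉ A ∧ Rc (off A ω) v x) +
        ∑ w, ind (w ∈ A) * ind (DC ω (fun S => Rc S v w) (fun S => Rc S w x))) := by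
        refine W_mono hp0 hp1 fun ω _ => ?_
        have hnn : ∀ w ∈ (Finset.univ : Finset V), 0 ≤
            ind (w ∈ A) * ind (DC ω (fun S => Rc S v w) (fun S => Rc S w x)) :=
          fun w _ => mul_nonneg (ind_nonneg _) (ind_nonneg _)
        by_cases h : Rc ω v x
        · rw [ind_true h]
          rcases through A h with h1 | ⟨w, hw, h1⟩
          · rw [ind_true h1]
            linarith [Finset.sum_nonneg hnn]
          · have := Finset.single_le_sum hnn (Finset.mem_univ w)
            rw [ind_true hw, ind_true h1] at this
            linarith [ind_nonneg (v ∉ A ∧ Rc (off A ω) v x)]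
        · rw [ind_false h]
          exact add_nonneg (ind_nonneg _) (Finset.sum_nonneg hnn)
    _ ≤ _ := by
        rw [W_add, W_sum]
        gcongr with w _
        rw [W_mul]
        exact mul_le_mul_of_nonneg_left (T_DC hp0 hp1 s v w w x) (ind_nonneg _)

theorem D_lower {p : ℝ} (hp0 : 0 ≤ p) (hp1 : p ≤ 1) (s : Finset (Sym2 V))
    (o u v x : V) :
    T p s o u * T p s v x -
      ∑ w, (∑ z, T p s o z * (T p s z u * T p s z w)) * (T p s v w * T p s w x) ≤
    W p s (fun ω => ind (Rc ω o u ∧ ¬ Rc ω o v ∧ Rc ω v x)) := by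
  have key : W p s (fun ω => ∑ A : Finset V, ind (Cl ω o = A ∧ u ∈ A) *
        ind (v ∉ A ∧ Rc (off A ω) v x)) ≤
      W p s (fun ω => ind (Rc ω o u ∧ ¬ Rc ω o v ∧ Rc ω v x)) := by
    refine W_mono hp0 hp1 fun ω _ => ?_
    rw [Finset.sum_eq_single (Cl ω o)]
    · rw [← ind_and]
      refine ind_mono ?_
      rintro ⟨⟨_, h1⟩, h2, h3⟩
      exact ⟨mem_Cl.1 h1, fun h => h2 (mem_Cl.2 h), Rc_mono (fun e he => (mem_off.1 he).1) h3⟩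
    · intro A _ hA
      rw [ind_false (fun h => hA h.1.symm), zero_mul]
    · simp
  refine le_trans ?_ key
  rw [W_sum]
  have h1 : ∀ A : Finset V, W p s (fun ω => ind (Cl ω o = A ∧ u ∈ A)) *
      (T p s v x - ∑ w, ind (w ∈ A) * (T p s v w * T p s w x)) ≤
      W p s (fun ω => ind (Cl ω o = A ∧ u ∈ A) * ind (v ∉ A ∧ Rc (off A ω) v x)) := by
    intro A
    rw [W_indep]
    · exact mul_le_mul_of_nonneg_left (T_off hp0 hp1 s A v x)
        (W_nonneg hp0 hp1 fun _ _ => ind_nonneg _)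
    · intro e
      by_cases he : ∀ a ∈ A, a ∉ e
      · left
        intro t
        rw [Cl_insert_iff he]
      · right
        intro t
        have : off A (insert e t) = off A t := by
          ext f
          rw [mem_off, mem_off, Finset.mem_insert]
          refine ⟨?_, fun h => ⟨Or.inr h.1, h.2⟩⟩
          rintro ⟨rfl | h, h'⟩
          · exact absurd h' he
          · exact ⟨h, h'⟩
        rw [this]
  refine le_trans ?_ (Finset.sum_le_sum fun A _ => h1 A)
  have h2 : ∑ A : Finset V, W p s (fun ω => ind (Cl ω o = A ∧ u ∈ A)) = T p s o u := by
    rw [← W_sum]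
    refine W_congr p fun ω _ => ?_
    rw [Finset.sum_eq_single (Cl ω o)]
    · exact ind_congr ⟨fun h => mem_Cl.1 h.2, fun h => ⟨rfl, mem_Cl.2 h⟩⟩
    · intro A _ hA
      exact ind_false (fun h => hA h.1.symm)
    · simp
  have h3 : ∀ w, ∑ A : Finset V, W p s (fun ω => ind (Cl ω o = A ∧ u ∈ A)) * ind (w ∈ A) =
      W p s (fun ω => ind (Rc ω o u ∧ Rc ω o w)) := by
    intro w
    simp_rw [← W_mul_right]
    rw [← W_sum]
    refine W_congr p fun ω _ => ?_
    rw [Finset.sum_eq_single (Cl ω o)]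
    · rw [← ind_and]
      exact ind_congr ⟨fun h => ⟨mem_Cl.1 h.1.2, mem_Cl.1 h.2⟩,
        fun h => ⟨⟨rfl, mem_Cl.2 h.1⟩, mem_Cl.2 h.2⟩⟩
    · intro A _ hA
      rw [ind_false (fun h => hA h.1.symm), zero_mul]
    · simp
  simp only [mul_sub, Finset.sum_sub_distrib, ← Finset.sum_mul, h2]
  refine sub_le_sub_left ?_ _
  simp only [Finset.mul_sum]
  rw [Finset.sum_comm]
  refine Finset.sum_le_sum fun w _ => ?_
  simp only [← mul_assoc]
  rw [← Finset.sum_mul, ← Finset.sum_mul, h3, mul_assoc, mul_assoc]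
  refine mul_le_mul_of_nonneg_right ?_
    (mul_nonneg (T_nonneg hp0 hp1 s v w) (T_nonneg hp0 hp1 s w x))
  simpa only [mul_assoc] using T_tree hp0 hp1 s o u w

end Graph2
section Deriv
variable {V : Type*} [Fintype V] [DecidableEq V]

/-- Susceptibility on the edge set `s`. -/
def X (p : ℝ) (s : Finset (Sym2 V)) (o : V) : ℝ := ∑ x, T p s o x

/-- The derivative of the susceptibility. -/
def dX (p : ℝ) (s : Finset (Sym2 V)) (o : V) : ℝ :=
  ∑ x, ∑ e ∈ s, W p (s.erase e) (fun t => ind (Rc (insert e t) o x) - ind (Rc t o x))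

theorem X_deriv (p : ℝ) (s : Finset (Sym2 V)) (o : V) :
    HasDerivAt (fun q => X q s o) (dX p s o) p := by
  unfold X dX T
  exact HasDerivAt.fun_sum fun x _ => W_deriv p s fun ω => ind (Rc ω o x)

theorem sum_edge {a b : V} (hab : a ≠ b) (F : V → V → ℝ) :
    ∑ u, ∑ v, ind (s(u, v) = s(a, b)) * F u v = F a b + F b a := by
  have h : ∀ u v, ind (s(u, v) = s(a, b)) * F u v =
      (if u = a then (if v = b then F u v else 0) else 0) +
      (if u = b then (if v = a then F u v else 0) else 0) := by
    intro u v
    by_cases h : s(u, v) = s(a, b)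
    · rw [ind_true h]
      rcases Sym2.eq_iff.1 h with ⟨rfl, rfl⟩ | ⟨rfl, rfl⟩
      · simp [hab]
      · simp [hab.symm]
    · rw [ind_false h]
      rw [Sym2.eq_iff, not_or] at h
      by_cases h1 : u = a <;> by_cases h2 : v = b <;> by_cases h3 : u = b <;> by_cases h4 : v = a <;>
        simp_all
  simp only [h, Finset.sum_add_distrib]
  simp

theorem sum_edges (s : Finset (Sym2 V)) (F : V → V → ℝ) :
    ∑ e ∈ s, ∑ u, ∑ v, ind (s(u, v) = e) * F u v = ∑ u, ∑ v, ind (s(u, v) ∈ s) * F u v := by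
  rw [Finset.sum_comm]
  refine Finset.sum_congr rfl fun u _ => ?_
  rw [Finset.sum_comm]
  refine Finset.sum_congr rfl fun v _ => ?_
  rw [← Finset.sum_mul]
  congr 1
  by_cases h : s(u, v) ∈ s
  · rw [ind_true h, Finset.sum_eq_single_of_mem _ h, ind_true rfl]
    intro b _ hb
    exact ind_false fun h => hb h.symm
  · rw [ind_false h]
    exact Finset.sum_eq_zero fun e he => ind_false fun h' => h (h' ▸ he)

theorem edge_upper {p : ℝ} (hp0 : 0 ≤ p) (hp1 : p ≤ 1) (s : Finset (Sym2 V))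
    (hs : ∀ e ∈ s, ¬ e.IsDiag) (o x : V) (e : Sym2 V) (he : e ∈ s) :
    W p (s.erase e) (fun t => ind (Rc (insert e t) o x) - ind (Rc t o x)) ≤
      ∑ u, ∑ v, ind (s(u, v) = e) * (T p s o u * T p s v x) := by
  have hd := hs e he
  induction e using Sym2.ind with
  | _ a b =>
    rw [Sym2.mk_isDiag_iff] at hd
    rw [sum_edge hd]
    have hm : ∀ x y : V, T p (s.erase s(a, b)) x y ≤ T p s x y := fun x y =>
      W_erase_le hp0 hp1 he fun A B h => ind_mono (Rc_mono h)
    have hmm : ∀ x y z w : V, T p (s.erase s(a, b)) x y * T p (s.erase s(a, b)) z w ≤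
        T p s x y * T p s z w := fun x y z w =>
      mul_le_mul (hm x y) (hm z w) (T_nonneg hp0 hp1 _ _ _) (T_nonneg hp0 hp1 _ _ _)
    refine le_trans ?_ (add_le_add ((T_DC hp0 hp1 (s.erase s(a, b)) o a b x).trans (hmm _ _ _ _))
      ((T_DC hp0 hp1 (s.erase s(a, b)) o b a x).trans (hmm _ _ _ _)))
    rw [← W_add]
    refine W_mono hp0 hp1 fun t _ => ?_
    by_cases h2 : Rc t o x
    · rw [ind_true h2]
      linarith [ind_le_one (Rc (insert s(a, b) t) o x),
        ind_nonneg (DC t (fun S => Rc S o a) fun S => Rc S b x),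
        ind_nonneg (DC t (fun S => Rc S o b) fun S => Rc S a x)]
    · rw [ind_false h2, sub_zero]
      by_cases h1 : Rc (insert s(a, b) t) o x
      · rw [ind_true h1]
        rcases Rc_insert h1 with h | ⟨h, h'⟩ | ⟨h, h'⟩
        · exact absurd h h2
        · rw [ind_true (DC_of_not h h' h2)]
          linarith [ind_nonneg (DC t (fun S => Rc S o b) fun S => Rc S a x)]
        · rw [ind_true (DC_of_not h h' h2)]
          linarith [ind_nonneg (DC t (fun S => Rc S o a) fun S => Rc S b x)]
      · rw [ind_false h1]
        exact add_nonneg (ind_nonneg _) (ind_nonneg _)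

theorem edge_lower {p : ℝ} (hp0 : 0 ≤ p) (hp1 : p ≤ 1) (s : Finset (Sym2 V))
    (hs : ∀ e ∈ s, ¬ e.IsDiag) (o x : V) (e : Sym2 V) (he : e ∈ s) :
    ∑ u, ∑ v, ind (s(u, v) = e) * W p s (fun ω => ind (Rc ω o u ∧ ¬ Rc ω o v ∧ Rc ω v x)) ≤
    W p (s.erase e) (fun t => ind (Rc (insert e t) o x) - ind (Rc t o x)) := by
  have hd := hs e he
  induction e using Sym2.ind with
  | _ a b =>
    rw [Sym2.mk_isDiag_iff] at hd
    rw [sum_edge hd]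
    have hm : ∀ u v : V, s(u, v) = s(a, b) → W p s (fun ω => ind (Rc ω o u ∧ ¬ Rc ω o v ∧ Rc ω v x)) ≤
        W p (s.erase s(a, b)) (fun ω => ind (Rc ω o u ∧ ¬ Rc ω o v ∧ Rc ω v x)) := by
      intro u v huv
      conv_lhs => rw [← Finset.insert_erase he, W_insert p (Finset.notMem_erase _ _)]
      have h0 : W p (s.erase s(a, b)) (fun t => ind (Rc (insert s(a, b) t) o u ∧
          ¬ Rc (insert s(a, b) t) o v ∧ Rc (insert s(a, b) t) v x)) = 0 := by
        rw [← W_const p 0 (s.erase s(a, b))]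
        refine W_congr p fun t _ => ind_false ?_
        rintro ⟨h1, h2, -⟩
        refine h2 (Rc_trans h1 ?_)
        rw [← huv]
        exact Rc_edge t u v
      rw [h0]
      have : 0 ≤ W p (s.erase s(a, b)) (fun ω => ind (Rc ω o u ∧ ¬ Rc ω o v ∧ Rc ω v x)) :=
        W_nonneg hp0 hp1 fun _ _ => ind_nonneg _
      nlinarith
    refine (add_le_add (hm a b rfl) (hm b a Sym2.eq_swap)).trans ?_
    rw [← W_add]
    refine W_mono hp0 hp1 fun t _ => ?_
    have hmon : ind (Rc t o x) ≤ ind (Rc (insert s(a, b) t) o x) :=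
      ind_mono (Rc_mono (Finset.subset_insert _ _))
    have hsub := Finset.subset_insert s(a, b) t
    by_cases h1 : Rc t o a ∧ ¬ Rc t o b ∧ Rc t b x
    · have h2 : ¬ (Rc t o b ∧ ¬ Rc t o a ∧ Rc t a x) := fun h => h1.2.1 h.1
      have h3 : ¬ Rc t o x := fun h => h1.2.1 (Rc_trans h (Rc_symm h1.2.2))
      have h4 : Rc (insert s(a, b) t) o x := Rc_trans (Rc_mono hsub h1.1)
        (Rc_trans (Rc_edge t a b) (Rc_mono hsub h1.2.2))
      rw [ind_true h1, ind_false h2, ind_false h3, ind_true h4]; norm_num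
    · rw [ind_false h1]
      by_cases h2 : Rc t o b ∧ ¬ Rc t o a ∧ Rc t a x
      · have h3 : ¬ Rc t o x := fun h => h2.2.1 (Rc_trans h (Rc_symm h2.2.2))
        have h4 : Rc (insert s(a, b) t) o x := Rc_trans (Rc_mono hsub h2.1)
          (Rc_trans (Rc_symm (Rc_edge t a b)) (Rc_mono hsub h2.2.2))
        rw [ind_true h2, ind_false h3, ind_true h4]; norm_num
      · rw [ind_false h2]; linarith

theorem dX_upper {p : ℝ} (hp0 : 0 ≤ p) (hp1 : p ≤ 1) (s : Finset (Sym2 V))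
    (hs : ∀ e ∈ s, ¬ e.IsDiag) (o : V) :
    dX p s o ≤ ∑ x, ∑ u, ∑ v, ind (s(u, v) ∈ s) * (T p s o u * T p s v x) := by
  unfold dX
  refine Finset.sum_le_sum fun x _ => ?_
  rw [← sum_edges]
  exact Finset.sum_le_sum fun e he => edge_upper hp0 hp1 s hs o x e he

theorem dX_lower {p : ℝ} (hp0 : 0 ≤ p) (hp1 : p ≤ 1) (s : Finset (Sym2 V))
    (hs : ∀ e ∈ s, ¬ e.IsDiag) (o : V) :
    ∑ x, ∑ u, ∑ v, ind (s(u, v) ∈ s) * (T p s o u * T p s v x -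
      ∑ w, (∑ z, T p s o z * (T p s z u * T p s z w)) * (T p s v w * T p s w x)) ≤ dX p s o := by
  unfold dX
  refine Finset.sum_le_sum fun x _ => ?_
  refine le_trans ?_ (Finset.sum_le_sum fun e he => edge_lower hp0 hp1 s hs o x e he)
  rw [sum_edges]
  refine Finset.sum_le_sum fun u _ => Finset.sum_le_sum fun v _ => ?_
  exact mul_le_mul_of_nonneg_left (D_lower hp0 hp1 s o u v x) (ind_nonneg _)

/-- The two differential inequalities, for a homogeneous edge set. -/
theorem diff_ineq {p : ℝ} (hp0 : 0 ≤ p) (hp1 : p ≤ 1) (s : Finset (Sym2 V))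
    (hs : ∀ e ∈ s, ¬ e.IsDiag) (Ω : ℝ) (o : V)
    (hdeg : ∀ u : V, ∑ v, ind (s(u, v) ∈ s) = Ω)
    (hinv : ∀ x y : V, ∃ φ : V ≃ V, φ x = y ∧ (∀ a b, T p s (φ a) (φ b) = T p s a b) ∧
      ∀ a b, ind (s(φ a, φ b) ∈ s) = ind (s(a, b) ∈ s))
    (a₀ : ℝ) (htri : ∀ u v : V, u ≠ v → ∑ z, ∑ w, T p s u z * T p s z w * T p s w v ≤ a₀) :
    Ω * (1 - a₀) * X p s o ^ 2 ≤ dX p s o ∧ dX p s o ≤ Ω * X p s o ^ 2 := by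
  have hX : ∀ y, X p s y = X p s o := by
    intro y
    obtain ⟨φ, h1, h2, -⟩ := hinv o y
    unfold X
    rw [← h1, ← Equiv.sum_comp φ]
    simp only [h2]
  have hX' : ∀ v, ∑ x, T p s v x = X p s o := hX
  have hXsymm : ∀ w, ∑ x, T p s x w = X p s o := fun w => by
    rw [← hX w]
    exact Finset.sum_congr rfl fun x _ => T_symm p s x w
  have hXnn : 0 ≤ X p s o := Finset.sum_nonneg fun x _ => T_nonneg hp0 hp1 s o x
  have hmain : ∑ x, ∑ u, ∑ v, ind (s(u, v) ∈ s) * (T p s o u * T p s v x) =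
      Ω * X p s o ^ 2 := by
    rw [Finset.sum_comm]
    have : ∀ u, ∑ x, ∑ v, ind (s(u, v) ∈ s) * (T p s o u * T p s v x) =
        T p s o u * (Ω * X p s o) := by
      intro u
      rw [Finset.sum_comm]
      have : ∀ v, ∑ x, ind (s(u, v) ∈ s) * (T p s o u * T p s v x) =
          ind (s(u, v) ∈ s) * (T p s o u * X p s o) := by
        intro v
        rw [← Finset.mul_sum, ← Finset.mul_sum, hX' v]
      simp only [this]
      rw [← Finset.sum_mul, hdeg]
      ring
    simp only [this]
    rw [← Finset.sum_mul, hX' o]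
    ring
  refine ⟨?_, hmain ▸ dX_upper hp0 hp1 s hs o⟩
  refine le_trans ?_ (dX_lower hp0 hp1 s hs o)
  simp only [mul_sub, Finset.sum_sub_distrib]
  rw [hmain]
  let F : V → ℝ := fun z => ∑ u, ∑ v, ∑ w, ind (s(u, v) ∈ s) * (T p s z u * T p s z w * T p s v w)
  have hF : ∀ y, F y = F o := by
    intro y
    obtain ⟨φ, h1, h2, h3⟩ := hinv o y
    simp only [F]
    rw [← h1, ← Equiv.sum_comp φ]
    refine Finset.sum_congr rfl fun u _ => ?_
    rw [← Equiv.sum_comp φ]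
    refine Finset.sum_congr rfl fun v _ => ?_
    rw [← Equiv.sum_comp φ]
    simp only [h2, h3]
  have hFsum : ∑ z, F z ≤ ∑ _z : V, Ω * a₀ := by
    simp only [F]
    rw [Finset.sum_comm]
    refine Finset.sum_le_sum fun u _ => ?_
    rw [Finset.sum_comm, ← hdeg u, Finset.sum_mul]
    refine Finset.sum_le_sum fun v _ => ?_
    simp only [← Finset.mul_sum]
    by_cases huv : s(u, v) ∈ s
    · refine mul_le_mul_of_nonneg_left ?_ (ind_nonneg _)
      have hne : u ≠ v := fun h => hs _ huv (Sym2.mk_isDiag_iff.2 h)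
      refine le_trans (le_of_eq ?_) (htri u v hne)
      refine Finset.sum_congr rfl fun z _ => Finset.sum_congr rfl fun w _ => ?_
      rw [T_symm p s z u, T_symm p s v w]
    · rw [ind_false huv]; simp
  have hFo : F o ≤ Ω * a₀ := by
    simp only [hF, Finset.sum_const, nsmul_eq_mul] at hFsum
    have hc : (0 : ℝ) < (Finset.univ : Finset V).card := by
      exact_mod_cast Finset.card_pos.2 ⟨o, Finset.mem_univ o⟩
    exact le_of_mul_le_mul_left hFsum hc
  have hrem : ∑ x, ∑ u, ∑ v, ind (s(u, v) ∈ s) *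
      ∑ w, (∑ z, T p s o z * (T p s z u * T p s z w)) * (T p s v w * T p s w x) =
      X p s o ^ 2 * F o := by
    calc _ = ∑ u, ∑ v, ∑ w, ∑ z, T p s o z * (ind (s(u, v) ∈ s) *
          (T p s z u * T p s z w * T p s v w)) * ∑ x, T p s w x := by
          rw [Finset.sum_comm]
          refine Finset.sum_congr rfl fun u _ => ?_
          rw [Finset.sum_comm]
          refine Finset.sum_congr rfl fun v _ => ?_
          simp only [Finset.mul_sum, Finset.sum_mul]
          rw [Finset.sum_comm]
          refine Finset.sum_congr rfl fun w _ => ?_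
          rw [Finset.sum_comm]
          refine Finset.sum_congr rfl fun z _ => ?_
          refine Finset.sum_congr rfl fun x _ => ?_
          ring
      _ = (∑ z, T p s o z * F z) * X p s o := by
          simp only [hX', ← Finset.sum_mul]
          congr 1
          simp only [F, Finset.mul_sum]
          symm
          rw [Finset.sum_comm]
          refine Finset.sum_congr rfl fun u _ => ?_
          rw [Finset.sum_comm]
          refine Finset.sum_congr rfl fun v _ => ?_
          rw [Finset.sum_comm]
      _ = _ := by
          simp only [hF, ← Finset.sum_mul, hX']
          ring
  rw [hrem]
  nlinarith [mul_le_mul_of_nonneg_left hFo (sq_nonneg (X p s o))]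

end Deriv
section Bridge
open Percolation
variable {V : Type*} [Fintype V] [DecidableEq V]

/-- The finite set of edges of `G`. -/
def es (G : SimpleGraph V) : Finset (Sym2 V) := Finset.univ.filter fun e => e ∈ G.edgeSet

theorem mem_es {G : SimpleGraph V} {e : Sym2 V} : e ∈ es G ↔ e ∈ G.edgeSet := by
  unfold es
  rw [Finset.mem_filter]
  simp

/-- The set of open edges of a configuration. -/
def op (G : SimpleGraph V) (ω : Config G) : Finset (Sym2 V) :=
  Finset.univ.filter fun e => ∃ h : e ∈ G.edgeSet, ω ⟨e, h⟩ = true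

theorem mem_op {G : SimpleGraph V} {ω : Config G} {e : Sym2 V} :
    e ∈ op G ω ↔ ∃ h : e ∈ G.edgeSet, ω ⟨e, h⟩ = true := by
  unfold op
  rw [Finset.mem_filter]
  simp

theorem reach_iff (G : SimpleGraph V) (ω : Config G) (x y : V) :
    (occupied G ω).Reachable x y ↔ Rc (op G ω) x y := by
  unfold occupied Rc
  have : {e | ∃ h : e ∈ G.edgeSet, ω ⟨e, h⟩ = true} = (op G ω : Set (Sym2 V)) := by
    ext e
    rw [Finset.mem_coe, mem_op]
    rfl
  rw [this]

theorem weight_eq (G : SimpleGraph V) (p : ℝ) (ω : Config G) :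
    weight G p ω = p ^ (op G ω).card * (1 - p) ^ (es G \ op G ω).card := by
  have h1 : weight G p ω = ∏ e : G.edgeSet, if (e : Sym2 V) ∈ op G ω then p else 1 - p := by
    unfold weight
    refine Finset.prod_congr rfl fun e _ => ?_
    have : (ω e = true) ↔ (e : Sym2 V) ∈ op G ω := by
      rw [mem_op]
      exact ⟨fun h => ⟨e.2, h⟩, fun ⟨_, h⟩ => h⟩
    by_cases h : ω e = true
    · rw [if_pos h, if_pos (this.1 h)]
    · rw [if_neg h, if_neg (fun h' => h (this.2 h'))]
  have h2 := Finset.prod_subtype (F := (inferInstance : Fintype G.edgeSet)) (p := fun e => e ∈ G.edgeSet) (es G) (fun e => mem_es)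
    (fun e => if e ∈ op G ω then p else 1 - p)
  rw [h1]
  refine h2.symm.trans ?_
  have hsub : op G ω ⊆ es G := fun e he => mem_es.2 (mem_op.1 he).1
  rw [← Finset.prod_sdiff hsub, mul_comm]
  congr 1
  · rw [Finset.prod_congr rfl (g := fun _ => p) (fun e he => if_pos he), Finset.prod_const]
  · rw [Finset.prod_congr rfl (g := fun _ => 1 - p)
      (fun e he => if_neg (Finset.mem_sdiff.1 he).2), Finset.prod_const]

theorem sum_config_s2 (G : SimpleGraph V) (p : ℝ) (F : Finset (Sym2 V) → ℝ) :
    ∑ ω : Config G, weight G p ω * F (op G ω) = W p (es G) F := by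
  unfold W
  refine Finset.sum_bij' (fun ω _ => op G ω)
    (fun t _ => (fun e : G.edgeSet => decide ((e : Sym2 V) ∈ t) : Config G)) ?_ ?_ ?_ ?_ ?_
  · intro ω _
    exact Finset.mem_powerset.2 fun e he => mem_es.2 (mem_op.1 he).1
  · intro t _
    exact Finset.mem_univ _
  · intro ω _
    funext e
    by_cases h : ω e = true
    · rw [h]
      simp only [decide_eq_true_eq]
      exact mem_op.2 ⟨e.2, h⟩
    · have h' : ω e = false := by simpa using h
      rw [h']
      simp only [decide_eq_false_iff_not]
      rintro h2
      exact h (mem_op.1 h2).2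
  · intro t ht
    ext e
    refine Iff.trans mem_op ?_
    constructor
    · rintro ⟨h, h'⟩
      simpa using h'
    · intro h
      exact ⟨mem_es.1 (Finset.mem_powerset.1 ht h), by simpa using h⟩
  · intro ω _
    rw [weight_eq]

theorem tau_eq (G : SimpleGraph V) (p : ℝ) (x y : V) : tau G p x y = T p (es G) x y := by
  unfold tau prob T
  rw [← sum_config_s2]
  refine Finset.sum_congr rfl fun ω _ => ?_
  by_cases h : (occupied G ω).Reachable x y
  · rw [if_pos h, ind_true ((reach_iff G ω x y).1 h), mul_one]
  · rw [if_neg h, ind_false (fun h' => h ((reach_iff G ω x y).2 h')), mul_zero]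

theorem chi_eq_s2 (G : SimpleGraph V) (p : ℝ) (o : V) : chi G o p = X p (es G) o := by
  unfold chi expect X T
  rw [← W_sum, ← sum_config_s2]
  refine Finset.sum_congr rfl fun ω _ => ?_
  congr 1
  unfold cluster
  beta_reduce
  rw [Finset.card_filter]
  push_cast
  refine Finset.sum_congr rfl fun y _ => ?_
  by_cases h : (occupied G ω).Reachable o y
  · rw [if_pos h, ind_true ((reach_iff G ω o y).1 h)]
  · rw [if_neg h, ind_false (fun h' => h ((reach_iff G ω o y).2 h'))]

theorem Rc_map (φ : V ≃ V) {t : Finset (Sym2 V)} {x y : V} (h : Rc t x y) :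
    Rc (t.image (Sym2.map φ)) (φ x) (φ y) := by
  obtain ⟨w⟩ := h
  induction w with
  | nil => exact Rc_refl _ _
  | @cons a b c hadj w ih =>
    refine Rc_trans ?_ ih
    rw [SimpleGraph.fromEdgeSet_adj] at hadj
    refine SimpleGraph.Adj.reachable ((SimpleGraph.fromEdgeSet_adj _).2 ⟨?_, ?_⟩)
    · rw [Finset.mem_coe, Finset.mem_image]
      exact ⟨s(a, b), hadj.1, rfl⟩
    · exact fun h => hadj.2 (φ.injective h)

theorem T_map (G : SimpleGraph V) (p : ℝ) (φ : G ≃g G) (x y : V) :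
    T p (es G) (φ x) (φ y) = T p (es G) x y := by
  let σ : Sym2 V ≃ Sym2 V :=
    ⟨Sym2.map φ, Sym2.map φ.symm, fun e => by
      induction e using Sym2.ind with
      | _ a b => simp, fun e => by
      induction e using Sym2.ind with
      | _ a b => simp⟩
  have himg : (es G).image σ = es G := by
    ext e
    rw [Finset.mem_image]
    constructor
    · rintro ⟨f, hf, rfl⟩
      rw [mem_es] at hf ⊢
      induction f using Sym2.ind with
      | _ a b => exact (φ.map_adj_iff).2 hf
    · intro he
      refine ⟨σ.symm e, ?_, by simp⟩
      rw [mem_es] at he ⊢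
      induction e using Sym2.ind with
      | _ a b => exact (φ.symm.map_adj_iff).2 he
  unfold T
  conv_lhs => rw [← himg, W_image]
  refine W_congr p fun t _ => ind_congr ⟨fun h => ?_, fun h => Rc_map φ.toEquiv h⟩
  have h' := Rc_map φ.symm.toEquiv h
  have e1 : (t.image σ).image (Sym2.map φ.symm.toEquiv) = t := by
    rw [Finset.image_image]
    have : (Sym2.map φ.symm.toEquiv ∘ σ) = id := funext fun e => σ.symm_apply_apply e
    rw [this, Finset.image_id]
  rw [e1] at h'
  simpa using h'

end Bridge
end PercAux
open Percolation in
/-- Theorem 1.2(i): bounds on the subcritical susceptibility under the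
triangle condition. -/
theorem subcritical_susceptibility
    {V : Type*} [Fintype V] [DecidableEq V]
    (G : SimpleGraph V) [DecidableRel G.Adj]
    (hconn : G.Connected) (htrans : IsTransitive G)
    (Ω : ℕ) (hreg : G.IsRegularOfDegree Ω)
    (x₀ : V)
    (lam : ℝ) (hlam : 0 < lam)
    (hlamV : 1 < lam * (Fintype.card V : ℝ) ^ ((1 : ℝ) / 3))
    (hlamV' : lam * (Fintype.card V : ℝ) ^ ((1 : ℝ) / 3) < (Fintype.card V : ℝ))
    (pc : ℝ) (hpc0 : 0 < pc) (hpc1 : pc < 1)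
    (hpc : chi G x₀ pc = lam * (Fintype.card V : ℝ) ^ ((1 : ℝ) / 3))
    (a₀ : ℝ) (ha₀ : a₀ < 1)
    (htri : ∀ x y : V, triangle G pc x y ≤ kron x y + a₀)
    (ε : ℝ) (hε : 0 ≤ ε)
    (p : ℝ) (hp : p = pc - (Ω : ℝ)⁻¹ * ε) (hp0 : 0 ≤ p) :
    1 / (1 / chi G x₀ pc + ε) ≤ chi G x₀ p ∧
      chi G x₀ p ≤ 1 / (1 / chi G x₀ pc + (1 - a₀) * ε) := by
  have hcard : (1 : ℝ) < Fintype.card V := hlamV.trans hlamV'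
  have hcard' : 1 < Fintype.card V := by exact_mod_cast hcard
  have : Nontrivial V := Fintype.one_lt_card_iff_nontrivial.1 hcard'
  have hΩ : 0 < Ω := by
    have := hconn.preconnected.degree_pos_of_nontrivial x₀
    rwa [hreg x₀] at this
  have hΩ' : (0 : ℝ) < Ω := by exact_mod_cast hΩ
  have hppc : p ≤ pc := by
    have : 0 ≤ (Ω : ℝ)⁻¹ * ε := by positivity
    linarith
  have hε' : Ω * (pc - p) = ε := by
    rw [hp]; field_simp; ring
  simp only [PercAux.chi_eq_s2]
  set s := PercAux.es G with hs_def
  have hdeg : ∀ u : V, ∑ v, PercAux.ind (s(u, v) ∈ s) = Ω := by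
    intro u
    rw [← hreg u, ← SimpleGraph.card_neighborFinset_eq_degree, Finset.card_eq_sum_ones]
    push_cast
    rw [SimpleGraph.neighborFinset_eq_filter, Finset.sum_filter]
    refine Finset.sum_congr rfl fun v _ => ?_
    by_cases h : G.Adj u v
    · rw [if_pos h, PercAux.ind_true (PercAux.mem_es.2 h)]
    · rw [if_neg h, PercAux.ind_false fun h' => h (PercAux.mem_es.1 h')]
  have hdiag : ∀ e ∈ s, ¬ e.IsDiag := fun e he =>
    G.not_isDiag_of_mem_edgeSet (PercAux.mem_es.1 he)
  have hdi : ∀ q, 0 ≤ q → q ≤ pc →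
      Ω * (1 - a₀) * PercAux.X q s x₀ ^ 2 ≤ PercAux.dX q s x₀ ∧
      PercAux.dX q s x₀ ≤ Ω * PercAux.X q s x₀ ^ 2 := by
    intro q hq0 hq1
    have hq2 : q ≤ 1 := hq1.trans hpc1.le
    refine PercAux.diff_ineq hq0 hq2 s hdiag Ω x₀ hdeg ?_ a₀ ?_
    · intro x y
      obtain ⟨φ, hφ⟩ := htrans x y
      refine ⟨φ.toEquiv, hφ, fun a b => PercAux.T_map G q φ a b, fun a b => ?_⟩
      refine PercAux.ind_congr ?_
      rw [PercAux.mem_es, PercAux.mem_es]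
      exact φ.map_adj_iff
    · intro u v huv
      have h := htri u v
      unfold triangle kron at h
      rw [if_neg huv, zero_add] at h
      simp only [PercAux.tau_eq] at h
      refine le_trans ?_ h
      have hm : ∀ x y : V, PercAux.T q s x y ≤ PercAux.T pc s x y := fun x y =>
        PercAux.W_mono_p hq0 hq1 hpc1.le s _ fun A B h => PercAux.ind_mono (PercAux.Rc_mono h)
      have h0 : ∀ x y : V, 0 ≤ PercAux.T q s x y := PercAux.T_nonneg hq0 hq2 s
      have h0' : ∀ x y : V, 0 ≤ PercAux.T pc s x y := PercAux.T_nonneg hpc0.le hpc1.le s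
      refine Finset.sum_le_sum fun z _ => Finset.sum_le_sum fun w _ => ?_
      exact mul_le_mul (mul_le_mul (hm _ _) (hm _ _) (h0 _ _) (h0' _ _)) (hm _ _) (h0 _ _)
        (mul_nonneg (h0' _ _) (h0' _ _))
  have hXpos : ∀ q, 0 ≤ q → q ≤ pc → 0 < PercAux.X q s x₀ := by
    intro q hq0 hq1
    have hq2 : q ≤ 1 := hq1.trans hpc1.le
    have h1 : PercAux.T q s x₀ x₀ = 1 := by
      rw [← PercAux.W_const q 1 s]
      exact PercAux.W_congr q fun t _ => PercAux.ind_true (PercAux.Rc_refl _ _)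
    have h2 : PercAux.T q s x₀ x₀ ≤ PercAux.X q s x₀ :=
      Finset.single_le_sum (f := fun y => PercAux.T q s x₀ y)
        (fun y _ => PercAux.T_nonneg hq0 hq2 s x₀ y) (Finset.mem_univ x₀)
    linarith
  have hder : ∀ q, 0 ≤ q → q ≤ pc → HasDerivAt (fun r => (PercAux.X r s x₀)⁻¹)
      (-PercAux.dX q s x₀ / PercAux.X q s x₀ ^ 2) q := fun q hq0 hq1 =>
    (PercAux.X_deriv q s x₀).fun_inv (hXpos q hq0 hq1).ne'
  have hcont : ContinuousOn (fun r => (PercAux.X r s x₀)⁻¹) (Set.Icc p pc) := fun q hq =>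
    (hder q (hp0.trans hq.1) hq.2).continuousAt.continuousWithinAt
  have hdiff : DifferentiableOn ℝ (fun r => (PercAux.X r s x₀)⁻¹) (interior (Set.Icc p pc)) :=
    fun q hq => (hder q (hp0.trans (interior_subset hq).1)
      (interior_subset hq).2).differentiableAt.differentiableWithinAt
  have hlow := (convex_Icc p pc).mul_sub_le_image_sub_of_le_deriv hcont hdiff (C := -Ω) (by
    intro q hq
    have h0 := hp0.trans (interior_subset hq).1
    have h1 := (interior_subset hq).2
    rw [(hder q h0 h1).deriv, le_div_iff₀ (pow_pos (hXpos q h0 h1) 2)]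
    linarith [(hdi q h0 h1).2]) p ⟨le_refl p, hppc⟩ pc ⟨hppc, le_refl pc⟩ hppc
  have hup := (convex_Icc p pc).image_sub_le_mul_sub_of_deriv_le hcont hdiff
    (C := -(Ω * (1 - a₀))) (by
    intro q hq
    have h0 := hp0.trans (interior_subset hq).1
    have h1 := (interior_subset hq).2
    rw [(hder q h0 h1).deriv, div_le_iff₀ (pow_pos (hXpos q h0 h1) 2)]
    linarith [(hdi q h0 h1).1]) p ⟨le_refl p, hppc⟩ pc ⟨hppc, le_refl pc⟩ hppc
  have hPp := hXpos p hp0 hppc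
  have hPc := hXpos pc hpc0.le le_rfl
  have hinvc : 0 < 1 / PercAux.X pc s x₀ := by positivity
  have e1 : (PercAux.X p s x₀)⁻¹ ≤ 1 / PercAux.X pc s x₀ + ε := by
    rw [one_div]; linarith
  have e2 : 1 / PercAux.X pc s x₀ + (1 - a₀) * ε ≤ (PercAux.X p s x₀)⁻¹ := by
    rw [one_div, ← hε']; linarith
  have h1a : 0 ≤ (1 - a₀) * ε := mul_nonneg (by linarith) hε
  constructor
  · rw [one_div]
    exact inv_le_of_inv_le₀ hPp e1
  · rw [one_div]
    exact (le_inv_comm₀ (by linarith) hPp).1 e2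
end
end
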